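/- (Critical embedding on a bounded Lipschitz domain.) Assume condition (D) and let Ω ⊂ ℝ^N be a bounded Lipschitz domain. Let r, s : Ω̄ → ℝ be continuous with 1 ≤ r(x) ≤ p*(x) and 1 ≤ s(x) ≤ q*(x) for all x ∈ Ω̄, and set F(x,t) := t^{r(x)} + a(x)^{s(x)/q(x)} t^{s(x)}. Then there exists C > 0 such that for every u ∈ C¹(ℝ^N): ‖u‖_{L^F(Ω)} ≤ C ‖u‖_{W^{1,H}(Ω)}. -/

import Mathlib

open MeasureTheory Filter
open scoped ENNReal

/-- The double phase integrand `H(x,t) = t^{p(x)} + a(x) t^{q(x)}`. -/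
noncomputable def Hfun {N : ℕ} (p q a : EuclideanSpace ℝ (Fin N) → ℝ)
    (x : EuclideanSpace ℝ (Fin N)) (t : ℝ) : ℝ :=
  t ^ p x + a x * t ^ q x

/-- The modular `ρ_V(u) = ∫_{ℝ^N} [H(x,|∇u|) + V(x) H(x,|u|)] dx`. -/
noncomputable def rhoV {N : ℕ} (p q a V : EuclideanSpace ℝ (Fin N) → ℝ)
    (u : EuclideanSpace ℝ (Fin N) → ℝ) : ℝ≥0∞ :=
  ∫⁻ x, (ENNReal.ofReal (Hfun p q a x ‖gradient u x‖) +
    ENNReal.ofReal (V x * Hfun p q a x |u x|))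

/-- The Luxemburg norm `‖u‖ = inf {τ > 0 : ρ_V(u/τ) ≤ 1}` associated with `ρ_V`. -/
noncomputable def VNorm {N : ℕ} (p q a V : EuclideanSpace ℝ (Fin N) → ℝ)
    (u : EuclideanSpace ℝ (Fin N) → ℝ) : ℝ :=
  sInf {τ : ℝ | 0 < τ ∧
    (∫⁻ x, (ENNReal.ofReal (Hfun p q a x (‖gradient u x‖ / τ)) +
      ENNReal.ofReal (V x * Hfun p q a x (|u x| / τ)))) ≤ 1}

/-- The Luxemburg norm `‖u‖_{L^Φ(U)}` of a Musielak integrand `Φ` on a set `U`. -/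
noncomputable def luxNormOn {N : ℕ} (Φ : EuclideanSpace ℝ (Fin N) → ℝ → ℝ)
    (U : Set (EuclideanSpace ℝ (Fin N))) (u : EuclideanSpace ℝ (Fin N) → ℝ) : ℝ :=
  sInf {τ : ℝ | 0 < τ ∧ (∫⁻ x in U, ENNReal.ofReal (Φ x (|u x| / τ))) ≤ 1}

/-- The Sobolev Luxemburg norm `‖u‖_{W^{1,H}(U)}`. -/
noncomputable def sobNormOn {N : ℕ} (p q a : EuclideanSpace ℝ (Fin N) → ℝ)
    (U : Set (EuclideanSpace ℝ (Fin N))) (u : EuclideanSpace ℝ (Fin N) → ℝ) : ℝ :=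
  sInf {τ : ℝ | 0 < τ ∧
    (∫⁻ x in U, (ENNReal.ofReal (Hfun p q a x (‖gradient u x‖ / τ)) +
      ENNReal.ofReal (Hfun p q a x (|u x| / τ)))) ≤ 1}

/-- The open cube `Q_{y,ε}` centered at `y` with edges parallel to the axes of length `ε`. -/
def cube {N : ℕ} (y : EuclideanSpace ℝ (Fin N)) (ε : ℝ) : Set (EuclideanSpace ℝ (Fin N)) :=
  {x | ∀ i, |x i - y i| < ε / 2}

/-- Condition (D): `p, q` bounded Lipschitz with `1 < inf p`, `sup q < N`,
`p < q < N` pointwise, `sup q/p < 1 + 1/N`; `a ≥ 0` bounded Lipschitz. -/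
structure CondD (N : ℕ) (p q a : EuclideanSpace ℝ (Fin N) → ℝ) : Prop where
  lip_p : ∃ K : NNReal, LipschitzWith K p
  lip_q : ∃ K : NNReal, LipschitzWith K q
  lip_a : ∃ K : NNReal, LipschitzWith K a
  inf_p : ∃ c > (1 : ℝ), ∀ x, c ≤ p x
  sup_q : ∃ c < (N : ℝ), ∀ x, q x ≤ c
  p_lt_q : ∀ x, p x < q x
  q_lt_N : ∀ x, q x < N
  ratio : ∃ c < 1 + 1 / (N : ℝ), ∀ x, q x / p x ≤ c
  a_nonneg : ∀ x, 0 ≤ a x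
  a_bdd : ∃ C : ℝ, ∀ x, a x ≤ C

/-- A bounded Lipschitz domain in `ℝ^{n+1}`: a bounded open set whose boundary is
locally, up to a rigid rotation, the graph of a Lipschitz function, with the domain
lying on one side of the graph. -/
def IsBoundedLipschitzDomain {n : ℕ} (Ω : Set (EuclideanSpace ℝ (Fin (n + 1)))) : Prop :=
  IsOpen Ω ∧ Bornology.IsBounded Ω ∧ Ω.Nonempty ∧
  ∀ x ∈ frontier Ω, ∃ (U : Set (EuclideanSpace ℝ (Fin (n + 1))))
    (e : EuclideanSpace ℝ (Fin (n + 1)) ≃ₗᵢ[ℝ] EuclideanSpace ℝ (Fin (n + 1)))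
    (f : EuclideanSpace ℝ (Fin n) → ℝ) (K : NNReal),
    x ∈ U ∧ IsOpen U ∧ LipschitzWith K f ∧
    Ω ∩ U = {y ∈ U |
      f ((WithLp.equiv 2 (Fin n → ℝ)).symm fun i => e y i.castSucc) < e y (Fin.last n)}

/-- The Gagliardo–Nirenberg–Sobolev inequality for a nonnegative function which is dominated
by the integrals of `h` over all lines in the directions of a fixed basis. -/
lemma exists_lintegral_rpow_le_of_le_lintegral_lines {m : ℕ} {p : ℝ}
    (hp : Real.HolderConjugate (m : ℝ) p)
    (A : (Fin m → ℝ) ≃L[ℝ] EuclideanSpace ℝ (Fin m)) :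
    ∃ C : ℝ≥0∞, C ≠ ⊤ ∧ ∀ G h : EuclideanSpace ℝ (Fin m) → ℝ≥0∞, Measurable h →
      (∀ x i, G x ≤ ∫⁻ t : ℝ, h (x + t • A (Pi.single i 1))) →
      ∫⁻ x, G x ^ p ≤ C * (∫⁻ x, h x) ^ p := by
  classical
  set ν : Measure (EuclideanSpace ℝ (Fin m)) := (volume : Measure (Fin m → ℝ)).map A
  let c := Measure.addHaarScalarFactor volume ν
  have hc : 0 < c := Measure.addHaarScalarFactor_pos_of_isAddHaarMeasure ..
  have hvol : (volume : Measure (EuclideanSpace ℝ (Fin m))) = c • ν :=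
    Measure.isAddLeftInvariant_eq_smul ..
  have hc0 : (c : ℝ≥0∞) ≠ 0 := by simpa using hc.ne'
  have hp0 : 0 ≤ p := hp.symm.nonneg
  have hA : MeasurableEmbedding A := A.toHomeomorph.measurableEmbedding
  have hm : (1 : ℝ) < m := hp.lt
  refine ⟨c * ((c : ℝ≥0∞)⁻¹) ^ p, ?_, fun G h hh hG => ?_⟩
  · exact ENNReal.mul_ne_top ENNReal.coe_ne_top
      (ENNReal.rpow_ne_top_of_nonneg hp0 (ENNReal.inv_ne_top.2 hc0))
  have hint : ∀ f : EuclideanSpace ℝ (Fin m) → ℝ≥0∞,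
      ∫⁻ x, f x = c * ∫⁻ s, f (A s) := by
    intro f
    rw [hvol, ENNReal.smul_def, lintegral_smul_measure, smul_eq_mul, hA.lintegral_map]
  have hline : ∀ (s : Fin m → ℝ) (i : Fin m),
      G (A s) ≤ ∫⁻ t : ℝ, h (A (Function.update s i t)) := by
    intro s i
    refine (hG (A s) i).trans_eq ?_
    rw [← lintegral_sub_right_eq_self (fun t : ℝ => h (A s + t • A (Pi.single i 1))) (s i)]
    refine lintegral_congr fun t => ?_
    rw [← map_smul, ← map_add]
    congr 2
    ext j
    by_cases hj : j = i
    · subst hj; simp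
    · simp [hj]
  have key : ∫⁻ s, G (A s) ^ p ≤ (∫⁻ s, h (A s)) ^ p := by
    calc ∫⁻ s, G (A s) ^ p
        = ∫⁻ s, ∏ _i : Fin m, G (A s) ^ ((1 : ℝ) / (m - 1)) := by
          refine lintegral_congr fun s => ?_
          rw [Finset.prod_const, Finset.card_univ, Fintype.card_fin, ← ENNReal.rpow_natCast,
            ← ENNReal.rpow_mul, hp.conjugate_eq]
          congr 1
          field_simp
      _ ≤ ∫⁻ s, ∏ i : Fin m, (∫⁻ t : ℝ, h (A (Function.update s i t))) ^ ((1 : ℝ) / (m - 1)) := by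
          have : (0 : ℝ) ≤ 1 / (m - 1) := div_nonneg zero_le_one (by linarith)
          exact lintegral_mono fun s => Finset.prod_le_prod' fun i _ =>
            ENNReal.rpow_le_rpow (hline s i) this
      _ ≤ (∫⁻ s, h (A s)) ^ p := by
          have := lintegral_prod_lintegral_pow_le (ι := Fin m) (fun _ => (volume : Measure ℝ))
            (p := p) (by simpa using hp) (f := fun s => h (A s))
            (hh.comp A.continuous.measurable)
          simpa [← volume_pi] using this
  rw [hint, hint h]
  calc (c : ℝ≥0∞) * ∫⁻ s, G (A s) ^ p ≤ c * (∫⁻ s, h (A s)) ^ p := by gcongr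
    _ = c * (c : ℝ≥0∞)⁻¹ ^ p * (c * ∫⁻ s, h (A s)) ^ p := by
        rw [mul_assoc, ← ENNReal.mul_rpow_of_nonneg _ _ hp0, ← mul_assoc,
          ENNReal.inv_mul_cancel hc0 ENNReal.coe_ne_top, one_mul]

lemma exists_pos_mul_norm_lt {ι E : Type*} [Fintype ι] [NormedAddCommGroup E] (v : ι → E)
    {ρ : ℝ} (hρ : 0 < ρ) : ∃ T > 0, ∀ i, ∀ t ∈ Set.Icc (0 : ℝ) T, t * ‖v i‖ < ρ := by
  have hS : 0 ≤ ∑ i, ‖v i‖ := Finset.sum_nonneg fun i _ => norm_nonneg _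
  refine ⟨ρ / (1 + ∑ i, ‖v i‖), by positivity, fun i t ht => ?_⟩
  have hi : ‖v i‖ ≤ ∑ i, ‖v i‖ :=
    Finset.single_le_sum (f := fun i => ‖v i‖) (fun i _ => norm_nonneg _) (Finset.mem_univ i)
  calc t * ‖v i‖ ≤ ρ / (1 + ∑ i, ‖v i‖) * ‖v i‖ := by gcongr; exact ht.2
    _ < ρ / (1 + ∑ i, ‖v i‖) * (1 + ∑ i, ‖v i‖) := by gcongr; linarith
    _ = ρ := by field_simp

/-- The shear `s ↦ (η s₀, …, η sₙ₋₁, ∑ sᵢ)`, which maps the coordinate vectors to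
almost vertical vectors. -/
lemma exists_linearEquiv_shear (n : ℕ) {η : ℝ} (hη : η ≠ 0) :
    ∃ B : (Fin (n + 1) → ℝ) ≃ₗ[ℝ] (Fin (n + 1) → ℝ), ∀ s,
      (∀ i : Fin n, B s i.castSucc = η * s i.castSucc) ∧ B s (Fin.last n) = ∑ i, s i := by
  let B₀ : (Fin (n + 1) → ℝ) →ₗ[ℝ] (Fin (n + 1) → ℝ) :=
    { toFun := fun s => Fin.snoc (fun i : Fin n => η * s i.castSucc) (∑ i, s i)
      map_add' := fun s t => by
        ext j
        refine Fin.lastCases ?_ (fun i => ?_) j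
        · simp [Finset.sum_add_distrib]
        · simp [mul_add]
      map_smul' := fun c s => by
        ext j
        refine Fin.lastCases ?_ (fun i => ?_) j
        · simp [Finset.mul_sum]
        · simp [mul_left_comm] }
  have hB₀ : ∀ s, (∀ i : Fin n, B₀ s i.castSucc = η * s i.castSucc) ∧
      B₀ s (Fin.last n) = ∑ i, s i := fun s => by simp [B₀]
  have hinj : Function.Injective B₀ := by
    rw [← LinearMap.ker_eq_bot, LinearMap.ker_eq_bot']
    intro s hs
    have h0 : ∀ i : Fin n, s i.castSucc = 0 := fun i => by
      have := (hB₀ s).1 i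
      rw [hs] at this
      simpa [hη] using this.symm
    have h1 := (hB₀ s).2
    rw [hs, Fin.sum_univ_castSucc] at h1
    ext j
    refine Fin.lastCases ?_ (fun i => h0 i) j
    simpa [h0] using h1.symm
  exact ⟨LinearEquiv.ofInjectiveEndo B₀ hinj, hB₀⟩

/-- A Lipschitz domain is locally stable under short translations along the vectors of a basis. -/
lemma IsBoundedLipschitzDomain.exists_basis_segment_mem {n : ℕ}
    {Ω : Set (EuclideanSpace ℝ (Fin (n + 1)))} (hΩ : IsBoundedLipschitzDomain Ω)
    {x : EuclideanSpace ℝ (Fin (n + 1))} (hx : x ∈ closure Ω) :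
    ∃ V : Set (EuclideanSpace ℝ (Fin (n + 1))), IsOpen V ∧ x ∈ V ∧
      ∃ A : (Fin (n + 1) → ℝ) ≃L[ℝ] EuclideanSpace ℝ (Fin (n + 1)), ∃ T > 0,
        ∀ y ∈ Ω ∩ V, ∀ i, ∀ t ∈ Set.Icc (0 : ℝ) T, y + t • A (Pi.single i 1) ∈ Ω := by
  obtain ⟨hopen, -, -, hbd⟩ := hΩ
  have shift : ∀ {ρ t : ℝ} {y v : EuclideanSpace ℝ (Fin (n + 1))}, y ∈ Metric.ball x ρ →
      0 ≤ t → t * ‖v‖ < ρ → y + t • v ∈ Metric.ball x (2 * ρ) := by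
    intro ρ t y v hy ht htv
    rw [Metric.mem_ball, dist_eq_norm] at hy ⊢
    calc ‖y + t • v - x‖ = ‖(y - x) + t • v‖ := by congr 1; abel
      _ ≤ ‖y - x‖ + ‖t • v‖ := norm_add_le _ _
      _ = ‖y - x‖ + t * ‖v‖ := by rw [norm_smul, Real.norm_of_nonneg ht]
      _ < 2 * ρ := by linarith
  by_cases hxΩ : x ∈ Ω
  · obtain ⟨ρ, hρ, hball⟩ := Metric.isOpen_iff.1 hopen x hxΩ
    let A := (EuclideanSpace.equiv (Fin (n + 1)) ℝ).symm
    obtain ⟨T, hT, hTs⟩ := exists_pos_mul_norm_lt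
      (fun i => A (Pi.single i (1 : ℝ))) (half_pos hρ)
    refine ⟨Metric.ball x (ρ / 2), Metric.isOpen_ball, Metric.mem_ball_self (half_pos hρ), A, T,
      hT, fun y hy i t ht => hball ?_⟩
    have := shift hy.2 ht.1 (hTs i t ht)
    rwa [mul_div_cancel₀ _ two_ne_zero] at this
  · obtain ⟨U, e, f, K, hxU, hU, hf, hgraph⟩ := hbd x
      (by rw [frontier, hopen.interior_eq]; exact ⟨hx, hxΩ⟩)
    obtain ⟨ρ, hρ, hball⟩ := Metric.isOpen_iff.1 hU x hxU
    set η : ℝ := 1 / (K + 1)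
    have hη : 0 < η := by positivity
    have hKη : K * η < 1 := by
      rw [mul_one_div, div_lt_one (by positivity)]; linarith
    obtain ⟨B, hB⟩ := exists_linearEquiv_shear n hη.ne'
    let A : (Fin (n + 1) → ℝ) ≃L[ℝ] EuclideanSpace ℝ (Fin (n + 1)) :=
      (B.toContinuousLinearEquiv.trans (EuclideanSpace.equiv (Fin (n + 1)) ℝ).symm).trans
        e.symm.toContinuousLinearEquiv
    have heA : ∀ s j, e (A s) j = B s j := fun s j => by simp [A]
    obtain ⟨T, hT, hTs⟩ := exists_pos_mul_norm_lt
      (fun i => A (Pi.single i (1 : ℝ))) (half_pos hρ)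
    refine ⟨Metric.ball x (ρ / 2), Metric.isOpen_ball, Metric.mem_ball_self (half_pos hρ), A, T,
      hT, fun y hy k t ht => ?_⟩
    have hin := shift hy.2 ht.1 (hTs k t ht)
    rw [mul_div_cancel₀ _ two_ne_zero] at hin
    have hyU : y ∈ U := hball (Metric.ball_subset_ball (half_le_self hρ.le) hy.2)
    have hyf : y ∈ Ω ∩ U := ⟨hy.1, hyU⟩
    rw [hgraph] at hyf
    have hmem : y + t • A (Pi.single k 1) ∈ Ω ∩ U := by
      rw [hgraph]
      refine ⟨hball hin, ?_⟩
      have hy2 := hyf.2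
      set Y : EuclideanSpace ℝ (Fin n) :=
        (WithLp.equiv 2 (Fin n → ℝ)).symm fun i => e y i.castSucc with hY
      set W : EuclideanSpace ℝ (Fin n) :=
        (WithLp.equiv 2 (Fin n → ℝ)).symm fun i => (Pi.single k (1 : ℝ) : Fin (n + 1) → ℝ) i.castSucc
        with hW
      have hWn : ‖W‖ ≤ 1 := by
        refine Fin.lastCases ?_ (fun i => ?_) k (motive := fun k => ‖((WithLp.equiv 2 (Fin n → ℝ)).symm
          fun i => (Pi.single k (1 : ℝ) : Fin (n + 1) → ℝ) i.castSucc : EuclideanSpace ℝ (Fin n))‖ ≤ 1)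
        · have : (fun i : Fin n => (Pi.single (Fin.last n) (1 : ℝ) : Fin (n + 1) → ℝ) i.castSucc)
              = 0 := by
            ext i; simp [Fin.castSucc_ne_last]
          rw [this]; simp
        · have : ((WithLp.equiv 2 (Fin n → ℝ)).symm
              fun j => (Pi.single i.castSucc (1 : ℝ) : Fin (n + 1) → ℝ) j.castSucc :
              EuclideanSpace ℝ (Fin n)) = EuclideanSpace.single i 1 := by
            ext j; simp [Pi.single_apply]
          rw [this]; simp
      have hfirst : ((WithLp.equiv 2 (Fin n → ℝ)).symm
          fun i => e (y + t • A (Pi.single k 1)) i.castSucc : EuclideanSpace ℝ (Fin n))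
            = Y + (t * η) • W := by
        ext i
        simp [hY, hW, heA, (hB _).1, mul_assoc]
      have hlast : e (y + t • A (Pi.single k 1)) (Fin.last n) = e y (Fin.last n) + t := by
        simp [heA, (hB _).2]
      rw [hfirst, hlast]
      rcases ht.1.eq_or_lt with h0 | h0
      · rw [← h0]; simpa using hy2
      have hlip := hf.dist_le_mul (Y + (t * η) • W) Y
      rw [Real.dist_eq, dist_eq_norm, add_sub_cancel_left, norm_smul,
        Real.norm_of_nonneg (by positivity)] at hlip
      have h1 : (K : ℝ) * (t * η * ‖W‖) ≤ t := by
        calc (K : ℝ) * (t * η * ‖W‖) ≤ K * (t * η * 1) := by gcongr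
          _ = t * (K * η) := by ring
          _ ≤ t * 1 := by gcongr
          _ = t := mul_one t
      linarith [le_abs_self (f (Y + (t * η) • W) - f Y)]
    exact hmem.1

/-- `h` controls the decrease of `g` along segments. -/
def IsLineGradBound {E : Type*} [NormedAddCommGroup E] [NormedSpace ℝ E]
    (g h : E → ℝ≥0∞) : Prop :=
  ∀ y v : E, ∀ t : ℝ, 0 ≤ t →
    g y ≤ g (y + t • v) + ‖v‖ₑ * ∫⁻ s in Set.Icc 0 t, h (y + s • v)

lemma IsLineGradBound.le_lintegral_Icc {E : Type*} [NormedAddCommGroup E] [NormedSpace ℝ E]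
    [MeasurableSpace E] [BorelSpace E] {g h : E → ℝ≥0∞} (hgh : IsLineGradBound g h)
    (hg : Measurable g) (hh : Measurable h) (y v : E) {T : ℝ} (hT : 0 < T) :
    g y ≤ ∫⁻ s in Set.Icc 0 T, ((ENNReal.ofReal T)⁻¹ + ‖v‖ₑ) * (g (y + s • v) + h (y + s • v)) := by
  have hT0 : ENNReal.ofReal T ≠ 0 := by simpa using hT
  have hline : Measurable fun s : ℝ => y + s • v := by fun_prop
  have hgm : Measurable fun s : ℝ => g (y + s • v) := hg.comp hline
  have hhm : Measurable fun s : ℝ => h (y + s • v) := hh.comp hline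
  set I := ∫⁻ s in Set.Icc 0 T, h (y + s • v)
  set J := ∫⁻ s in Set.Icc 0 T, g (y + s • v)
  have h1 : ENNReal.ofReal T * g y ≤ J + ENNReal.ofReal T * (‖v‖ₑ * I) := by
    calc ENNReal.ofReal T * g y = ∫⁻ _ in Set.Icc 0 T, g y := by simp [mul_comm]
      _ ≤ ∫⁻ t in Set.Icc 0 T, (g (y + t • v) + ‖v‖ₑ * I) := by
          refine setLIntegral_mono' measurableSet_Icc fun t ht => ?_
          refine (hgh y v t ht.1).trans ?_
          gcongr
          exact lintegral_mono_set (Set.Icc_subset_Icc_right ht.2)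
      _ = J + ENNReal.ofReal T * (‖v‖ₑ * I) := by
          rw [lintegral_add_left hgm]
          simp [mul_comm, J]
  calc g y = (ENNReal.ofReal T)⁻¹ * (ENNReal.ofReal T * g y) := by
        rw [← mul_assoc, ENNReal.inv_mul_cancel hT0 ENNReal.ofReal_ne_top, one_mul]
    _ ≤ (ENNReal.ofReal T)⁻¹ * (J + ENNReal.ofReal T * (‖v‖ₑ * I)) := by gcongr
    _ = (ENNReal.ofReal T)⁻¹ * J + ‖v‖ₑ * I := by
        rw [mul_add, ← mul_assoc _ (ENNReal.ofReal T),
          ENNReal.inv_mul_cancel hT0 ENNReal.ofReal_ne_top, one_mul]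
    _ ≤ ((ENNReal.ofReal T)⁻¹ + ‖v‖ₑ) * (J + I) := by
        rw [add_mul]
        gcongr
        · exact le_self_add
        · exact le_add_self
    _ = _ := by
        have hsum : Measurable fun s : ℝ => g (y + s • v) + h (y + s • v) := hgm.add hhm
        rw [lintegral_const_mul _ hsum, lintegral_add_left hgm]

/-- The Sobolev inequality `W^{1,1}(Ω) ⊂ L^{N/(N-1)}(Ω)` on a bounded Lipschitz domain. -/
lemma IsBoundedLipschitzDomain.exists_lintegral_rpow_le {n : ℕ}
    {Ω : Set (EuclideanSpace ℝ (Fin (n + 1)))} (hΩ : IsBoundedLipschitzDomain Ω)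
    {p : ℝ} (hp : Real.HolderConjugate ((n + 1 : ℕ) : ℝ) p) :
    ∃ C : ℝ≥0∞, C ≠ ⊤ ∧ ∀ g h : EuclideanSpace ℝ (Fin (n + 1)) → ℝ≥0∞,
      Measurable g → Measurable h → IsLineGradBound g h →
      ∫⁻ x in Ω, g x ^ p ≤ C * (∫⁻ x in Ω, (g x + h x)) ^ p := by
  have hp0 : 0 < p := hp.symm.pos
  have hmΩ : MeasurableSet Ω := hΩ.1.measurableSet
  suffices H : ∃ C : ℝ≥0∞, C ≠ ⊤ ∧ ∀ g h : EuclideanSpace ℝ (Fin (n + 1)) → ℝ≥0∞,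
      Measurable g → Measurable h → IsLineGradBound g h →
      ∫⁻ x in Ω ∩ closure Ω, g x ^ p ≤ C * (∫⁻ x in Ω, (g x + h x)) ^ p by
    rwa [Set.inter_eq_left.2 subset_closure] at H
  have hcomp : IsCompact (closure Ω) := hΩ.2.1.isCompact_closure
  refine hcomp.induction_on (p := fun S => ∃ C : ℝ≥0∞, C ≠ ⊤ ∧
      ∀ g h : EuclideanSpace ℝ (Fin (n + 1)) → ℝ≥0∞,
      Measurable g → Measurable h → IsLineGradBound g h →
      ∫⁻ x in Ω ∩ S, g x ^ p ≤ C * (∫⁻ x in Ω, (g x + h x)) ^ p) ?_ ?_ ?_ ?_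
  · exact ⟨0, by simp, fun g h _ _ _ => by simp⟩
  · rintro S S' hSS' ⟨C, hC, H⟩
    exact ⟨C, hC, fun g h hg hh hgh =>
      (lintegral_mono_set (Set.inter_subset_inter_right _ hSS')).trans (H g h hg hh hgh)⟩
  · rintro S S' ⟨C, hC, H⟩ ⟨C', hC', H'⟩
    refine ⟨C + C', ENNReal.add_ne_top.2 ⟨hC, hC'⟩, fun g h hg hh hgh => ?_⟩
    rw [Set.inter_union_distrib_left, add_mul]
    exact (lintegral_union_le _ _ _).trans (add_le_add (H g h hg hh hgh) (H' g h hg hh hgh))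
  · intro x hx
    obtain ⟨V, hV, hxV, A, T, hT, hseg⟩ := hΩ.exists_basis_segment_mem hx
    obtain ⟨C, hC, H⟩ := exists_lintegral_rpow_le_of_le_lintegral_lines hp A
    refine ⟨V, mem_nhdsWithin_of_mem_nhds (hV.mem_nhds hxV), ?_⟩
    set D : ℝ≥0∞ := (ENNReal.ofReal T)⁻¹ + ∑ i, ‖A (Pi.single i 1)‖ₑ with hD
    have hDtop : D ≠ ⊤ := by
      refine ENNReal.add_ne_top.2 ⟨ENNReal.inv_ne_top.2 (by simpa using hT), ?_⟩
      exact ENNReal.sum_ne_top.2 fun i _ => enorm_ne_top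
    refine ⟨C * D ^ p, ENNReal.mul_ne_top hC (ENNReal.rpow_ne_top_of_nonneg hp0.le hDtop),
      fun g h hg hh hgh => ?_⟩
    have key := H ((Ω ∩ V).indicator g) (Ω.indicator fun z => D * (g z + h z))
      (((hg.add hh).const_mul D).indicator hmΩ) ?_
    · calc ∫⁻ z in Ω ∩ V, g z ^ p = ∫⁻ z, (Ω ∩ V).indicator g z ^ p := by
            rw [← lintegral_indicator (hmΩ.inter hV.measurableSet)]
            refine lintegral_congr fun z => ?_
            by_cases hz : z ∈ Ω ∩ V <;> simp [hz, hp0]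
        _ ≤ _ := key
        _ = C * D ^ p * (∫⁻ z in Ω, (g z + h z)) ^ p := by
            have hsum : Measurable fun z => g z + h z := hg.add hh
            rw [lintegral_indicator hmΩ, lintegral_const_mul _ hsum,
              ENNReal.mul_rpow_of_nonneg _ _ hp0.le, mul_assoc]
    · intro y i
      by_cases hy : y ∈ Ω ∩ V
      · rw [Set.indicator_of_mem hy]
        refine (hgh.le_lintegral_Icc hg hh y (A (Pi.single i 1)) hT).trans ?_
        rw [← lintegral_indicator measurableSet_Icc]
        refine lintegral_mono fun t => ?_
        by_cases ht : t ∈ Set.Icc (0 : ℝ) T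
        · rw [Set.indicator_of_mem ht, Set.indicator_of_mem (hseg y hy i t ht)]
          rw [hD]
          gcongr
          exact Finset.single_le_sum (f := fun i => ‖A (Pi.single i (1 : ℝ))‖ₑ)
            (fun i _ => zero_le) (Finset.mem_univ i)
        · simp [ht]
      · simp [hy]

lemma IsLineGradBound.of_ae_abs_deriv_le {E : Type*} [NormedAddCommGroup E] [NormedSpace ℝ E]
    {φ B : E → ℝ}
    (hlip : ∀ y v : E, ∀ t, 0 ≤ t → ∃ L : NNReal,
      LipschitzOnWith L (fun s : ℝ => φ (y + s • v)) (Set.Icc 0 t))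
    (hder : ∀ y v : E, ∀ᵐ s : ℝ, |deriv (fun s : ℝ => φ (y + s • v)) s| ≤ ‖v‖ * B (y + s • v)) :
    IsLineGradBound (fun x => ENNReal.ofReal (φ x)) (fun x => ENNReal.ofReal (B x)) := by
  intro y v t ht
  set f : ℝ → ℝ := fun s => φ (y + s • v) with hf
  obtain ⟨L, hL⟩ := hlip y v t ht
  rw [← Set.uIcc_of_le ht] at hL
  have hFTC := hL.absolutelyContinuousOnInterval.integral_deriv_eq_sub
  have h0 : φ y = f t + (f 0 - f t) := by simp [hf]
  have h1 : ENNReal.ofReal (f 0 - f t) ≤ ‖v‖ₑ * ∫⁻ s in Set.Icc 0 t, ENNReal.ofReal (B (y + s • v)) := by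
    calc ENNReal.ofReal (f 0 - f t) ≤ ENNReal.ofReal |f t - f 0| := by
          apply ENNReal.ofReal_le_ofReal
          rw [abs_sub_comm]
          exact le_abs_self _
      _ = ‖∫ s in Set.Ioc 0 t, deriv f s‖ₑ := by
          rw [← hFTC, intervalIntegral.integral_of_le ht, Real.enorm_eq_ofReal_abs]
      _ ≤ ∫⁻ s in Set.Ioc 0 t, ‖deriv f s‖ₑ := enorm_integral_le_lintegral_enorm _
      _ ≤ ∫⁻ s in Set.Ioc 0 t, ‖v‖ₑ * ENNReal.ofReal (B (y + s • v)) := by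
          refine lintegral_mono_ae (ae_restrict_of_ae ?_)
          filter_upwards [hder y v] with s hs
          rw [Real.enorm_eq_ofReal_abs, ← ofReal_norm v,
            ← ENNReal.ofReal_mul (norm_nonneg v)]
          exact ENNReal.ofReal_le_ofReal hs
      _ = ‖v‖ₑ * ∫⁻ s in Set.Ioc 0 t, ENNReal.ofReal (B (y + s • v)) :=
          lintegral_const_mul' _ _ enorm_ne_top
      _ ≤ _ := by gcongr; exact Set.Ioc_subset_Icc_self
  calc ENNReal.ofReal (φ y) = ENNReal.ofReal (f t + (f 0 - f t)) := by rw [h0]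
    _ ≤ ENNReal.ofReal (f t) + ENNReal.ofReal (f 0 - f t) := ENNReal.ofReal_add_le
    _ ≤ _ := by gcongr

/-- The function `a ^ (q*/(1* q)) t ^ (q*/1*)`, where `q* = N q / (N - q)`. -/
noncomputable def subcritPow (N q a t : ℝ) : ℝ :=
  a ^ ((N - 1) / (N - q)) * t ^ (q * ((N - 1) / (N - q)))

lemma subcritPow_nonneg {N q a t : ℝ} (ha : 0 ≤ a) (ht : 0 ≤ t) : 0 ≤ subcritPow N q a t := by
  unfold subcritPow; positivity

lemma contDiffOn_subcritPow (N : ℝ) :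
    ContDiffOn ℝ 1 (fun X : ℝ × ℝ × ℝ => subcritPow N X.1 X.2.1 X.2.2)
      (Set.Iio N ×ˢ Set.Ioi 0 ×ˢ Set.Ioi 0) := by
  have h1 : ContDiffOn ℝ 1 (fun X : ℝ × ℝ × ℝ => (N - 1) / (N - X.1))
      (Set.Iio N ×ˢ Set.Ioi 0 ×ˢ Set.Ioi 0) :=
    ContDiffOn.div contDiffOn_const (contDiffOn_const.sub contDiffOn_fst)
      fun X hX => (sub_pos.2 hX.1).ne'
  refine ContDiffOn.mul (ContDiffOn.rpow (by fun_prop) h1 fun X hX => (Set.mem_Ioi.1 hX.2.1).ne')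
    (ContDiffOn.rpow (by fun_prop) (contDiffOn_fst.mul h1) fun X hX => (Set.mem_Ioi.1 hX.2.2).ne')

lemma exists_lipschitzOnWith_subcritPow {N : ℝ} {q a u : ℝ → ℝ} {s : Set ℝ} {K : NNReal}
    (hs : IsCompact s) (hq : LipschitzOnWith K q s) (ha : LipschitzOnWith K a s)
    (hu : LipschitzOnWith K u s) (hqN : ∀ x ∈ s, q x < N) (ha0 : ∀ x ∈ s, 0 < a x)
    (hu0 : ∀ x ∈ s, 0 < u x) :
    ∃ L : NNReal, LipschitzOnWith L (fun x => subcritPow N (q x) (a x) (u x)) s := by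
  set X : ℝ → ℝ × ℝ × ℝ := fun x => (q x, a x, u x)
  have hX : LipschitzOnWith (max K (max K K)) X s := hq.prodMk (ha.prodMk hu)
  have hlip : LocallyLipschitzOn (X '' s) (fun X : ℝ × ℝ × ℝ => subcritPow N X.1 X.2.1 X.2.2) := by
    rintro _ ⟨x, hx, rfl⟩
    have hO : IsOpen (Set.Iio N ×ˢ Set.Ioi (0 : ℝ) ×ˢ Set.Ioi (0 : ℝ)) :=
      isOpen_Iio.prod (isOpen_Ioi.prod isOpen_Ioi)
    have hxO : X x ∈ Set.Iio N ×ˢ Set.Ioi (0 : ℝ) ×ˢ Set.Ioi (0 : ℝ) :=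
      ⟨hqN x hx, ha0 x hx, hu0 x hx⟩
    obtain ⟨L, t, ht, hL⟩ :=
      ((contDiffOn_subcritPow N).contDiffAt (hO.mem_nhds hxO)).exists_lipschitzOnWith
    exact ⟨L, t, mem_nhdsWithin_of_mem_nhds ht, hL⟩
  obtain ⟨L, hL⟩ := hlip.exists_lipschitzOnWith_of_compact (hs.image_of_continuousOn hX.continuousOn)
  exact ⟨_, hL.comp hX (Set.mapsTo_image X s)⟩

lemma LipschitzWith.comp_line {E : Type*} [NormedAddCommGroup E] [NormedSpace ℝ E]
    {f : E → ℝ} {K : NNReal} (hf : LipschitzWith K f) (y v : E) :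
    LipschitzWith (K * ‖v‖₊) (fun s : ℝ => f (y + s • v)) := by
  refine LipschitzWith.of_dist_le_mul fun s t => (hf.dist_le_mul _ _).trans_eq ?_
  rw [dist_add_left, dist_eq_norm, ← sub_smul, norm_smul, Real.dist_eq, Real.norm_eq_abs]
  push_cast
  ring

lemma hasDerivAt_subcritPow {N : ℝ} {q a u : ℝ → ℝ} {q' a' u' s : ℝ} (hq : HasDerivAt q q' s)
    (ha : HasDerivAt a a' s) (hu : HasDerivAt u u' s) (hqN : q s < N) (ha0 : 0 < a s)
    (hu0 : 0 < u s) :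
    HasDerivAt (fun s => subcritPow N (q s) (a s) (u s))
      (subcritPow N (q s) (a s) (u s) *
        ((N - 1) / (N - q s) * a' * (1 / a s) + (N - 1) / (N - q s) ^ 2 * q' * Real.log (a s) +
          q s * ((N - 1) / (N - q s)) * (u' / u s) +
          ((N - 1) / (N - q s) + q s * ((N - 1) / (N - q s) ^ 2)) * q' * Real.log (u s))) s := by
  have hNq : N - q s ≠ 0 := (sub_pos.2 hqN).ne'
  have hγ : HasDerivAt (fun s => (N - 1) / (N - q s)) ((N - 1) / (N - q s) ^ 2 * q') s :=
    ((hasDerivAt_const s (N - 1)).fun_div (hq.const_sub N) hNq).congr_deriv (by field_simp; ring)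
  have hqγ := hq.fun_mul hγ
  refine ((ha.rpow hγ ha0).fun_mul (hu.rpow hqγ hu0)).congr_deriv ?_
  rw [subcritPow, Real.rpow_sub_one ha0.ne', Real.rpow_sub_one hu0.ne']
  ring

/-- Bound for the variation along lines of `subcritPow N (q x) (a x) (u x)`. -/
lemma exists_isLineGradBound_subcritPow {N c : ℝ} (hN : 1 ≤ N) (hc : 0 < c) (K : NNReal) :
    ∃ M : ℝ, 0 ≤ M ∧ ∀ {E : Type} [NormedAddCommGroup E] [NormedSpace ℝ E] (q a u : E → ℝ),
      LipschitzWith K q → LipschitzWith K a → (∀ x, 0 ≤ q x) → (∀ x, q x ≤ N - c) →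
      (∀ x, 0 < a x) → ContDiff ℝ 1 u → (∀ x, 0 < u x) →
      IsLineGradBound (fun x => ENNReal.ofReal (subcritPow N (q x) (a x) (u x)))
        (fun x => ENNReal.ofReal (M * (subcritPow N (q x) (a x) (u x) *
          (|Real.log (a x)| + |Real.log (u x)| + 1 / a x + ‖fderiv ℝ u x‖ / u x)))) := by
  set M : ℝ := K * (N / c) + K * (N / c ^ 2) + N * (N / c) + K * (N / c + N * (N / c ^ 2)) with hM
  have hN0 : 0 ≤ N := by linarith
  refine ⟨M, by positivity, fun {E} _ _ q a u hq ha hq0 hqN ha0 hu hu0 => ?_⟩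
  refine IsLineGradBound.of_ae_abs_deriv_le (fun y v t _ => ?_) fun y v => ?_
  · have hline : ContDiff ℝ 1 fun s : ℝ => u (y + s • v) := hu.comp (by fun_prop)
    obtain ⟨K', hK'⟩ := hline.contDiffOn.exists_lipschitzOnWith (s := Set.Icc 0 t)
      (by decide) (convex_Icc _ _) isCompact_Icc
    refine exists_lipschitzOnWith_subcritPow (K := max (K * ‖v‖₊) K') isCompact_Icc
      (((LipschitzWith.comp_line hq y v).weaken (le_max_left _ _)).lipschitzOnWith)
      (((LipschitzWith.comp_line ha y v).weaken (le_max_left _ _)).lipschitzOnWith)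
      (hK'.weaken (le_max_right _ _)) (fun s _ => ?_) (fun s _ => ha0 _) fun s _ => hu0 _
    linarith [hqN (y + s • v)]
  · have hql := LipschitzWith.comp_line hq y v
    have hal := LipschitzWith.comp_line ha y v
    filter_upwards [hql.ae_differentiableAt_real, hal.ae_differentiableAt_real] with s hqs has
    have hq' := hqs.hasDerivAt
    have ha' := has.hasDerivAt
    have hqb := norm_deriv_le_of_lipschitz (x₀ := s) hql
    have hab := norm_deriv_le_of_lipschitz (x₀ := s) hal
    set q' := deriv (fun s : ℝ => q (y + s • v)) s
    set a' := deriv (fun s : ℝ => a (y + s • v)) s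
    set x := y + s • v with hx
    have hline : HasDerivAt (fun s : ℝ => y + s • v) v s := by
      simpa using ((hasDerivAt_id s).smul_const v).const_add y
    have hu' : HasDerivAt (fun s : ℝ => u (y + s • v)) (fderiv ℝ u x v) s :=
      ((hu.differentiable one_ne_zero x).hasFDerivAt).comp_hasDerivAt s hline
    have hub : |fderiv ℝ u x v| ≤ ‖fderiv ℝ u x‖ * ‖v‖ := (fderiv ℝ u x).le_opNorm v
    set u' := fderiv ℝ u x v
    have hNq : c ≤ N - q x := by linarith [hqN x]
    have hNq0 : 0 < N - q x := by linarith
    have hφ' := (hasDerivAt_subcritPow hq' ha' hu' (show q (y + s • v) < N from sub_pos.1 hNq0)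
      (ha0 _) (hu0 _)).deriv
    simp only [← hx] at hφ'
    set γ := (N - 1) / (N - q x) with hγ
    set γ₁ := (N - 1) / (N - q x) ^ 2 with hγ₁
    have hγ0 : 0 ≤ γ := div_nonneg (by linarith) hNq0.le
    have hγ₁0 : 0 ≤ γ₁ := div_nonneg (by linarith) (by positivity)
    have hγb : γ ≤ N / c := div_le_div₀ hN0 (by linarith) hc hNq
    have hγ₁b : γ₁ ≤ N / c ^ 2 := div_le_div₀ hN0 (by linarith) (by positivity) (by gcongr)
    have hqN' : q x ≤ N := by linarith
    rw [hφ', abs_mul, abs_of_nonneg (subcritPow_nonneg (ha0 x).le (hu0 x).le)]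
    have hv := norm_nonneg v
    have hqb' : |q'| ≤ K * ‖v‖ := by simpa using hqb
    have hab' : |a'| ≤ K * ‖v‖ := by simpa using hab
    have hax : 0 < 1 / a x := one_div_pos.2 (ha0 x)
    have hd : 0 ≤ ‖fderiv ℝ u x‖ / u x := div_nonneg (norm_nonneg _) (hu0 x).le
    have t1 : |γ * a' * (1 / a x)| ≤ K * (N / c) * (‖v‖ * (1 / a x)) := by
      rw [abs_mul, abs_mul, abs_of_nonneg hγ0, abs_of_pos hax]
      calc γ * |a'| * (1 / a x) ≤ N / c * (K * ‖v‖) * (1 / a x) := by gcongr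
        _ = _ := by ring
    have t2 : |γ₁ * q' * Real.log (a x)| ≤ K * (N / c ^ 2) * (‖v‖ * |Real.log (a x)|) := by
      rw [abs_mul, abs_mul, abs_of_nonneg hγ₁0]
      calc γ₁ * |q'| * |Real.log (a x)| ≤ N / c ^ 2 * (K * ‖v‖) * |Real.log (a x)| := by gcongr
        _ = _ := by ring
    have t3 : |q x * γ * (u' / u x)| ≤ N * (N / c) * (‖v‖ * (‖fderiv ℝ u x‖ / u x)) := by
      rw [abs_mul, abs_mul, abs_of_nonneg hγ0, abs_of_nonneg (hq0 x), abs_div, abs_of_pos (hu0 x)]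
      have := hu0 x
      calc q x * γ * (|u'| / u x) ≤ N * (N / c) * (‖fderiv ℝ u x‖ * ‖v‖ / u x) := by gcongr
        _ = _ := by ring
    have t4 : |(γ + q x * γ₁) * q' * Real.log (u x)| ≤
        K * (N / c + N * (N / c ^ 2)) * (‖v‖ * |Real.log (u x)|) := by
      have := hq0 x
      rw [abs_mul, abs_mul, abs_of_nonneg (by positivity)]
      calc (γ + q x * γ₁) * |q'| * |Real.log (u x)|
          ≤ (N / c + N * (N / c ^ 2)) * (K * ‖v‖) * |Real.log (u x)| := by gcongr
        _ = _ := by ring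
    have key : |γ * a' * (1 / a x) + γ₁ * q' * Real.log (a x) +
          q x * γ * (u' / u x) + (γ + q x * γ₁) * q' * Real.log (u x)| ≤
        M * (‖v‖ * (|Real.log (a x)| + |Real.log (u x)| + 1 / a x + ‖fderiv ℝ u x‖ / u x)) := by
      have P1 : 0 ≤ K * (N / c) := by positivity
      have P2 : 0 ≤ K * (N / c ^ 2) := by positivity
      have P3 : 0 ≤ N * (N / c) := by positivity
      have P4 : 0 ≤ K * (N / c + N * (N / c ^ 2)) := by positivity
      have e1 : K * (N / c) ≤ M := by linarith
      have e2 : K * (N / c ^ 2) ≤ M := by linarith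
      have e3 : N * (N / c) ≤ M := by linarith
      have e4 : K * (N / c + N * (N / c ^ 2)) ≤ M := by linarith
      refine (abs_add_le _ _).trans ((add_le_add ((abs_add_le _ _).trans
        (add_le_add (abs_add_le _ _) le_rfl)) le_rfl).trans ?_)
      calc
        _ ≤ M * (‖v‖ * (1 / a x)) + M * (‖v‖ * |Real.log (a x)|) +
            M * (‖v‖ * (‖fderiv ℝ u x‖ / u x)) + M * (‖v‖ * |Real.log (u x)|) := by
          refine add_le_add (add_le_add (add_le_add (t1.trans ?_) (t2.trans ?_)) (t3.trans ?_))
            (t4.trans ?_) <;> gcongr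
        _ = _ := by ring
    calc _ ≤ subcritPow N (q x) (a x) (u x) * _ :=
          mul_le_mul_of_nonneg_left key (subcritPow_nonneg (ha0 x).le (hu0 x).le)
      _ = _ := by ring

/-- The function `a ^ (q*/q) t ^ q*`, where `q* = N q / (N - q)`. -/
noncomputable def critPow (N q a t : ℝ) : ℝ :=
  a ^ (N / (N - q)) * t ^ (q * (N / (N - q)))

lemma critPow_nonneg {N q a t : ℝ} (ha : 0 ≤ a) (ht : 0 ≤ t) : 0 ≤ critPow N q a t := by
  unfold critPow; positivity

lemma subcritPow_rpow {N q a t : ℝ} (hN : 1 < N) (ha : 0 ≤ a) (ht : 0 ≤ t) :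
    subcritPow N q a t ^ (N / (N - 1)) = critPow N q a t := by
  have hN' : N - 1 ≠ 0 := (sub_pos.2 hN).ne'
  have h : (N - 1) / (N - q) * (N / (N - 1)) = N / (N - q) := by
    rw [div_mul_div_comm, mul_comm (N - q), mul_div_mul_left _ _ hN']
  rw [subcritPow, critPow, Real.mul_rpow (by positivity) (by positivity), ← Real.rpow_mul ha,
    ← Real.rpow_mul ht, mul_assoc, h]

lemma one_add_abs_le_exp {η : ℝ} (hη : 0 < η) (w : ℝ) :
    1 + |w| ≤ (1 + 2 / η) * Real.exp (η / 2 * |w|) := by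
  have h1 : 1 ≤ Real.exp (η / 2 * |w|) := Real.one_le_exp (by positivity)
  have h2 : η / 2 * |w| ≤ Real.exp (η / 2 * |w|) := by
    linarith [Real.add_one_le_exp (η / 2 * |w|)]
  have h3 : |w| = 2 / η * (η / 2 * |w|) := by field_simp
  have h4 : 2 / η * (η / 2 * |w|) ≤ 2 / η * Real.exp (η / 2 * |w|) := by gcongr
  linarith

/-- Interpolation of an intermediate exponential, with a logarithmic loss. -/
lemma exists_exp_mul_one_add_abs_le {η P δ : ℝ} (hη : 0 < η) (hδ : 0 < δ) :
    ∃ C : ℝ, 0 ≤ C ∧ ∀ w α τ β : ℝ, α + η ≤ τ → τ + η ≤ β → τ - α ≤ P →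
      Real.exp (τ * w) * (1 + |w|) ≤ δ * Real.exp (β * w) + C * Real.exp (α * w) := by
  set k : ℝ := 1 + 2 / η with hk
  have hk1 : 1 ≤ k := by have : 0 < 2 / η := by positivity
                         linarith
  set T : ℝ := max 0 (2 / η * Real.log (k / δ)) with hT
  have hT0 : 0 ≤ T := le_max_left _ _
  refine ⟨k * Real.exp ((|P| + η) * T), by positivity, fun w α τ β h1 h2 h3 => ?_⟩
  have hkT : 1 ≤ Real.exp ((|P| + η) * T) := Real.one_le_exp (by positivity)
  have hlog := one_add_abs_le_exp hη w
  have hmain : Real.exp (τ * w) * (1 + |w|) ≤ k * Real.exp (τ * w + η / 2 * |w|) := by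
    rw [Real.exp_add]
    calc _ ≤ Real.exp (τ * w) * (k * Real.exp (η / 2 * |w|)) := by gcongr
      _ = _ := by ring
  refine hmain.trans ?_
  have hβ : 0 ≤ δ * Real.exp (β * w) := by positivity
  have hα : 0 ≤ k * Real.exp ((|P| + η) * T) * Real.exp (α * w) := by positivity
  rcases le_total w 0 with hw | hw
  · have : k * Real.exp (τ * w + η / 2 * |w|) ≤
        k * Real.exp ((|P| + η) * T) * Real.exp (α * w) := by
      rw [mul_assoc]
      refine mul_le_mul_of_nonneg_left ?_ (by linarith)
      calc Real.exp (τ * w + η / 2 * |w|) ≤ Real.exp (α * w) := by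
            apply Real.exp_le_exp.2
            rw [abs_of_nonpos hw]
            nlinarith
        _ ≤ _ := le_mul_of_one_le_left (Real.exp_pos _).le hkT
    linarith
  rw [abs_of_nonneg hw]
  rcases le_total w T with hwT | hwT
  · have : k * Real.exp (τ * w + η / 2 * w) ≤
        k * Real.exp ((|P| + η) * T) * Real.exp (α * w) := by
      rw [mul_assoc, ← Real.exp_add]
      refine mul_le_mul_of_nonneg_left (Real.exp_le_exp.2 ?_) (by linarith)
      have e1 : (τ - α + η / 2) * w ≤ (|P| + η) * w := by
        gcongr
        · exact h3.trans (le_abs_self P)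
        · linarith
      have e2 : (|P| + η) * w ≤ (|P| + η) * T := by gcongr
      linarith
    linarith
  · have : k * Real.exp (τ * w + η / 2 * w) ≤ δ * Real.exp (β * w) := by
      have e1 : k / δ ≤ Real.exp (η / 2 * w) := by
        rw [← Real.log_le_iff_le_exp (by positivity)]
        calc Real.log (k / δ) = η / 2 * (2 / η * Real.log (k / δ)) := by field_simp
          _ ≤ η / 2 * w := by gcongr; exact (le_max_right _ _).trans hwT
      rw [div_le_iff₀ hδ] at e1
      calc k * Real.exp (τ * w + η / 2 * w)
          ≤ Real.exp (η / 2 * w) * δ * Real.exp (τ * w + η / 2 * w) := by gcongr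
        _ = δ * Real.exp ((τ + η) * w) := by
          rw [mul_comm _ δ, mul_assoc, ← Real.exp_add]; ring_nf
        _ ≤ _ := by gcongr
    linarith

lemma exists_exp_le {η P δ : ℝ} (hη : 0 < η) (hδ : 0 < δ) :
    ∃ C : ℝ, 0 ≤ C ∧ ∀ w z τ β : ℝ, η ≤ τ → τ + η ≤ β → τ ≤ P →
      Real.exp (τ * w + z) ≤ δ * Real.exp (β * w + z) + C * Real.exp z := by
  obtain ⟨C, hC, h⟩ := exists_exp_mul_one_add_abs_le (P := P) hη hδ
  refine ⟨C, hC, fun w z τ β h1 h2 h3 => ?_⟩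
  have h4 := h w 0 τ β (by linarith) h2 (by linarith)
  have h5 : Real.exp (τ * w) ≤ Real.exp (τ * w) * (1 + |w|) :=
    le_mul_of_one_le_right (Real.exp_pos _).le (by linarith [abs_nonneg w])
  rw [zero_mul, Real.exp_zero, mul_one] at h4
  rw [Real.exp_add, Real.exp_add, ← mul_assoc, ← add_mul]
  exact mul_le_mul_of_nonneg_right (h5.trans h4) (Real.exp_pos z).le

lemma subcritPow_eq_exp {N q a t : ℝ} (hq : 0 < q) (ha : 0 < a) (ht : 0 < t) :
    subcritPow N q a t =
      Real.exp (q * ((N - 1) / (N - q)) * (Real.log a / q + Real.log t)) := by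
  rw [subcritPow, Real.rpow_def_of_pos ha, Real.rpow_def_of_pos ht, ← Real.exp_add]
  congr 1
  field_simp

lemma critPow_eq_exp {N q a t : ℝ} (hq : 0 < q) (ha : 0 < a) (ht : 0 < t) :
    critPow N q a t = Real.exp (q * (N / (N - q)) * (Real.log a / q + Real.log t)) := by
  rw [critPow, Real.rpow_def_of_pos ha, Real.rpow_def_of_pos ht, ← Real.exp_add]
  congr 1
  field_simp

lemma mul_rpow_eq_exp {q a t : ℝ} (hq : 0 < q) (ha : 0 < a) (ht : 0 < t) :
    a * t ^ q = Real.exp (q * (Real.log a / q + Real.log t)) := by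
  rw [Real.rpow_def_of_pos ht]
  nth_rw 1 [← Real.exp_log ha]
  rw [← Real.exp_add]
  congr 1
  field_simp

lemma exists_subcritPow_mul_one_add_abs_le {N c δ : ℝ} (hN : 1 < N) (hc : 0 < c) (hδ : 0 < δ) :
    ∃ C : ℝ, 0 ≤ C ∧ ∀ q a t : ℝ, 1 + c ≤ q → q ≤ N - c → 0 < a → 0 < t →
      subcritPow N q a t * (1 + |Real.log a / q + Real.log t|) ≤
        δ * critPow N q a t + C * (a * t ^ q) := by
  obtain ⟨C, hC, h⟩ := exists_exp_mul_one_add_abs_le (η := min (c / N) (1 / N)) (P := N * (N / c))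
    (by positivity) hδ
  refine ⟨C, hC, fun q a t h1 h2 ha ht => ?_⟩
  have hq : 0 < q := by linarith
  have hqN : q < N := by linarith
  rw [subcritPow_eq_exp hq ha ht, critPow_eq_exp hq ha ht, mul_rpow_eq_exp hq ha ht]
  have hNq : 0 < N - q := by linarith
  refine h _ q _ _ ?_ ?_ ?_
  · have e : q * ((N - 1) / (N - q)) = q + q * (q - 1) / (N - q) := by field_simp; ring
    rw [e]
    have : c / N ≤ q * (q - 1) / (N - q) :=
      div_le_div₀ (by nlinarith) (by nlinarith) hNq (by linarith)
    linarith [min_le_left (c / N) (1 / N)]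
  · have e : q * (N / (N - q)) = q * ((N - 1) / (N - q)) + q / (N - q) := by field_simp; ring
    rw [e]
    have : 1 / N ≤ q / (N - q) := div_le_div₀ (by linarith) (by linarith) hNq (by linarith)
    linarith [min_le_right (c / N) (1 / N)]
  · have : q * ((N - 1) / (N - q)) ≤ N * (N / c) := by
      have : (N - 1) / (N - q) ≤ N / c := div_le_div₀ (by linarith) (by linarith) hc (by linarith)
      gcongr
    linarith

lemma exists_subcritPow_mul_div_le {N c δ : ℝ} (hc : 0 < c) (hδ : 0 < δ) :
    ∃ C : ℝ, 0 ≤ C ∧ ∀ q a t d : ℝ, 1 + c ≤ q → q ≤ N - c → 0 < a → 0 < t → 0 ≤ d →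
      subcritPow N q a t * (d / t) ≤ δ * critPow N q a t + C * (a * d ^ q) := by
  obtain ⟨C, hC, h⟩ := exists_exp_le (η := min c 1) (P := N) (by positivity) hδ
  refine ⟨C, hC, fun q a t d h1 h2 ha ht hd => ?_⟩
  have hq : 0 < q := by linarith
  have hqN : q < N := by linarith
  have hNq : 0 < N - q := by linarith
  rcases hd.eq_or_lt with rfl | hd
  · have := critPow_nonneg (N := N) (q := q) ha.le ht.le
    simp only [zero_div, mul_zero, Real.zero_rpow hq.ne', add_zero]
    positivity
  rw [subcritPow_eq_exp hq ha ht, critPow_eq_exp hq ha ht, mul_rpow_eq_exp hq ha hd,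
    ← Real.exp_log (div_pos hd ht), ← Real.exp_add, Real.log_div hd.ne' ht.ne']
  set x := Real.log a / q + Real.log d
  set y := Real.log a / q + Real.log t
  have key := h (N / (N - q) * y - x) (q * x) (q - 1) q
    (by linarith [min_le_left c 1]) (by linarith [min_le_right c 1]) (by linarith)
  have e1 : q * ((N - 1) / (N - q)) * y + (Real.log d - Real.log t) =
      (q - 1) * (N / (N - q) * y - x) + q * x := by
    rw [show Real.log d - Real.log t = x - y by ring]
    field_simp
    ring
  have e2 : q * (N / (N - q)) * y = q * (N / (N - q) * y - x) + q * x := by ring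
  rwa [e1, e2]

lemma exists_subcritPow_div_le {N c δ : ℝ} (hN : 1 < N) (hc : 0 < c) (hδ : 0 < δ) :
    ∃ C : ℝ, 0 ≤ C ∧ ∀ p q a t : ℝ, 0 < p → p ≤ q → N * q ≤ (N + 1) * p →
      1 + c ≤ q → q ≤ N - c → 0 < a → 0 < t →
      subcritPow N q a t * (1 / a) ≤
        δ * critPow N q a t + C * (t ^ p + t ^ (p * (N / (N - p)))) := by
  obtain ⟨C, hC, h⟩ := exists_exp_le (η := min (c / N) (1 / N)) (P := 1) (by positivity) hδ
  refine ⟨C, hC, fun p q a t hp hpq hpq' h1 h2 ha ht => ?_⟩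
  have hq : 0 < q := by linarith
  have hqN : q < N := by linarith
  have hNq : 0 < N - q := by linarith
  have hNp : 0 < N - p := by linarith
  have hNq1 : 0 < N - q + 1 := by linarith
  set m : ℝ := N * q / (N - q + 1) with hm
  have hmp : p ≤ m := by
    refine hpq.trans ?_
    rw [hm, le_div_iff₀ hNq1]
    nlinarith
  have hmp' : m ≤ p * (N / (N - p)) := by
    rw [hm, mul_div_assoc', div_le_div_iff₀ hNq1 hNp]
    nlinarith
  have htm : t ^ m ≤ t ^ p + t ^ (p * (N / (N - p))) := by
    rcases le_total t 1 with h1 | h1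
    · have := Real.rpow_le_rpow_of_exponent_ge ht h1 hmp
      have : 0 ≤ t ^ (p * (N / (N - p))) := by positivity
      linarith
    · have := Real.rpow_le_rpow_of_exponent_le h1 hmp'
      have : 0 ≤ t ^ p := by positivity
      linarith
  refine le_trans ?_ (add_le_add_right (mul_le_mul_of_nonneg_left htm hC) _)
  have hθ1 : c / N ≤ (q - 1) / N := by gcongr; linarith
  have hθ2 : (q - 1) / N = 1 - 1 / N - (N - q) / N := by field_simp; ring
  have hθ3 : 0 ≤ (N - q) / N := by positivity
  have h1N : 0 < 1 / N := by positivity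
  have key := h (q * (N / (N - q)) * (Real.log a / q + Real.log t) - m * Real.log t)
    (m * Real.log t) ((q - 1) / N) 1 (by linarith [min_le_left (c / N) (1 / N)])
    (by linarith [min_le_right (c / N) (1 / N)]) (by linarith)
  rw [one_mul, sub_add_cancel] at key
  rw [subcritPow_eq_exp hq ha ht, critPow_eq_exp hq ha ht, Real.rpow_def_of_pos ht,
    ← Real.exp_log (one_div_pos.2 ha), ← Real.exp_add, one_div, Real.log_inv, mul_comm _ m]
  have e1 : q * ((N - 1) / (N - q)) * (Real.log a / q + Real.log t) + -Real.log a =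
      (q - 1) / N * (q * (N / (N - q)) * (Real.log a / q + Real.log t) - m * Real.log t) +
        m * Real.log t := by
    rw [hm]
    field_simp
    ring
  rwa [e1]

lemma exists_lineGrad_le {N c A δ : ℝ} (hN : 1 < N) (hc : 0 < c) (hA : 0 ≤ A) (hδ : 0 < δ) :
    ∃ C : ℝ, 0 ≤ C ∧ ∀ q a t d : ℝ, 1 + c ≤ q → q ≤ N - c → 0 < a → a ≤ A → 0 < t → 0 ≤ d →
      subcritPow N q a t * (1 + (|Real.log a| + |Real.log t| + 1 / a + d / t)) ≤
        δ * critPow N q a t + C * (a * (t ^ q + d ^ q)) + 3 * (subcritPow N q a t * (1 / a)) := by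
  obtain ⟨C₁, hC₁, h₁⟩ := exists_subcritPow_mul_one_add_abs_le hN hc
    (δ := δ / 2 / (1 + 2 * A)) (by positivity)
  obtain ⟨C₂, hC₂, h₂⟩ := exists_subcritPow_mul_div_le hc (half_pos hδ)
  refine ⟨(1 + 2 * A) * C₁ + C₂, by positivity, fun q a t d hq1 hq2 ha haA ht hd => ?_⟩
  have i1 := mul_le_mul_of_nonneg_left (h₁ q a t hq1 hq2 ha ht) (show 0 ≤ 1 + 2 * A by positivity)
  have i2 := h₂ q a t d hq1 hq2 ha ht hd
  have hφ := subcritPow_nonneg (N := N) (q := q) ha.le ht.le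
  set φ := subcritPow N q a t
  set w := Real.log a / q + Real.log t with hw
  have hq : 0 < q := by linarith
  have hla : |Real.log a| ≤ A + 1 / a := by
    have e1 := Real.log_le_sub_one_of_pos ha
    have e2 := Real.log_le_sub_one_of_pos (one_div_pos.2 ha)
    rw [one_div, Real.log_inv, ← one_div] at e2
    have := one_div_pos.2 ha
    exact abs_le.2 ⟨by linarith, by linarith⟩
  have hlt : |Real.log t| ≤ |w| + |Real.log a| := by
    have e : Real.log t = w - Real.log a / q := by rw [hw]; ring
    have e3 : |Real.log a / q| ≤ |Real.log a| := by
      rw [abs_div, abs_of_pos hq]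
      exact div_le_self (abs_nonneg _) (by linarith)
    rw [e]
    exact (abs_sub _ _).trans (by gcongr)
  have hsum : 1 + (|Real.log a| + |Real.log t| + 1 / a + d / t) ≤
      (1 + 2 * A) * (1 + |w|) + 3 * (1 / a) + d / t := by
    nlinarith [mul_nonneg hA (abs_nonneg w)]
  have i3 := mul_le_mul_of_nonneg_left hsum hφ
  have e4 : (1 + 2 * A) * (δ / 2 / (1 + 2 * A) * critPow N q a t + C₁ * (a * t ^ q)) =
      δ / 2 * critPow N q a t + (1 + 2 * A) * C₁ * (a * t ^ q) := by
    have : 1 + 2 * A ≠ 0 := by positivity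
    field_simp
  have p1 : 0 ≤ C₂ * (a * t ^ q) := by positivity
  have p2 : 0 ≤ (1 + 2 * A) * C₁ * (a * d ^ q) := by positivity
  rw [e4] at i1
  linarith

/-- Pointwise absorption inequality for the exponent `q` with unit weight. -/
lemma exists_lineGrad_one_le {N c δ : ℝ} (hN : 1 < N) (hc : 0 < c) (hδ : 0 < δ) :
    ∃ C : ℝ, 0 ≤ C ∧ ∀ q t d : ℝ, 1 + c ≤ q → q ≤ N - c → 0 < t → 0 ≤ d →
      subcritPow N q 1 t * (1 + (|Real.log 1| + |Real.log t| + 1 / 1 + d / t)) ≤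
        δ * critPow N q 1 t + C * (t ^ q + d ^ q) := by
  obtain ⟨C₁, hC₁, h₁⟩ := exists_lineGrad_le hN hc zero_le_one (half_pos hδ)
  obtain ⟨C₂, hC₂, h₂⟩ := exists_subcritPow_mul_one_add_abs_le hN hc (δ := δ / 6) (by positivity)
  refine ⟨C₁ + 3 * C₂, by positivity, fun q t d hq1 hq2 ht hd => ?_⟩
  have i1 := h₁ q 1 t d hq1 hq2 one_pos le_rfl ht hd
  have i2 := h₂ q 1 t hq1 hq2 one_pos ht
  have hφ := subcritPow_nonneg (N := N) (q := q) zero_le_one ht.le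
  have i3 := mul_nonneg hφ (abs_nonneg (Real.log 1 / q + Real.log t))
  have p1 : 0 ≤ C₂ * d ^ q := by positivity
  rw [one_div_one, mul_one] at *
  linarith

/-- Pointwise absorption inequality for the exponent `q` with weight `a`. -/
lemma exists_lineGrad_weight_le {N c A δ : ℝ} (hN : 1 < N) (hc : 0 < c) (hA : 0 ≤ A)
    (hδ : 0 < δ) :
    ∃ C : ℝ, 0 ≤ C ∧ ∀ p q a t d : ℝ, 0 < p → p ≤ q → N * q ≤ (N + 1) * p →
      1 + c ≤ q → q ≤ N - c → 0 < a → a ≤ A → 0 < t → 0 ≤ d →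
      subcritPow N q a t * (1 + (|Real.log a| + |Real.log t| + 1 / a + d / t)) ≤
        δ * critPow N q a t +
          C * (t ^ p + t ^ (p * (N / (N - p))) + a * (t ^ q + d ^ q)) := by
  obtain ⟨C₁, hC₁, h₁⟩ := exists_lineGrad_le hN hc hA (half_pos hδ)
  obtain ⟨C₂, hC₂, h₂⟩ := exists_subcritPow_div_le hN hc (δ := δ / 6) (by positivity)
  refine ⟨C₁ + 3 * C₂, by positivity, fun p q a t d hp hpq hpq' hq1 hq2 ha haA ht hd => ?_⟩
  have i1 := h₁ q a t d hq1 hq2 ha haA ht hd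
  have i2 := h₂ p q a t hp hpq hpq' hq1 hq2 ha ht
  have p1 : 0 ≤ C₁ * (t ^ p + t ^ (p * (N / (N - p)))) := by positivity
  have p2 : 0 ≤ C₂ * (a * (t ^ q + d ^ q)) := by positivity
  linarith

lemma continuous_subcritPow {X : Type*} [TopologicalSpace X] {N : ℝ} {q a u : X → ℝ}
    (hq : Continuous q) (ha : Continuous a) (hu : Continuous u) (hqN : ∀ x, q x < N)
    (ha0 : ∀ x, 0 < a x) (hu0 : ∀ x, 0 < u x) :
    Continuous fun x => subcritPow N (q x) (a x) (u x) := by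
  have h1 : Continuous fun x => (N - 1) / (N - q x) :=
    continuous_const.div (continuous_const.sub hq) fun x => (sub_pos.2 (hqN x)).ne'
  exact (ha.rpow h1 fun x => Or.inl (ha0 x).ne').mul
    (hu.rpow (hq.mul h1) fun x => Or.inl (hu0 x).ne')

lemma continuous_critPow {X : Type*} [TopologicalSpace X] {N : ℝ} {q a u : X → ℝ}
    (hq : Continuous q) (ha : Continuous a) (hu : Continuous u) (hqN : ∀ x, q x < N)
    (ha0 : ∀ x, 0 < a x) (hu0 : ∀ x, 0 < u x) :
    Continuous fun x => critPow N (q x) (a x) (u x) := by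
  have h1 : Continuous fun x => N / (N - q x) :=
    continuous_const.div (continuous_const.sub hq) fun x => (sub_pos.2 (hqN x)).ne'
  exact (ha.rpow h1 fun x => Or.inl (ha0 x).ne').mul
    (hu.rpow (hq.mul h1) fun x => Or.inl (hu0 x).ne')

lemma critPow_mul {N q a l t : ℝ} (hl : 0 ≤ l) (ht : 0 ≤ t) :
    critPow N q a (l * t) = l ^ (q * (N / (N - q))) * critPow N q a t := by
  rw [critPow, critPow, Real.mul_rpow hl ht]
  ring

/-- Sobolev inequality for `critPow` on a Lipschitz domain. -/
lemma IsBoundedLipschitzDomain.exists_lintegral_critPow_le {n : ℕ}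
    {Ω : Set (EuclideanSpace ℝ (Fin (n + 1)))} (hΩ : IsBoundedLipschitzDomain Ω) {N : ℝ}
    (hNn : N = ((n + 1 : ℕ) : ℝ)) (hN : 1 < N) {c : ℝ} (hc : 0 < c) (K : NNReal) :
    ∃ C : ℝ≥0∞, C ≠ ⊤ ∧ ∀ q a u : EuclideanSpace ℝ (Fin (n + 1)) → ℝ,
      LipschitzWith K q → LipschitzWith K a → (∀ x, 0 ≤ q x) → (∀ x, q x ≤ N - c) →
      (∀ x, 0 < a x) → ContDiff ℝ 1 u → (∀ x, 0 < u x) →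
      ∫⁻ x in Ω, ENNReal.ofReal (critPow N (q x) (a x) (u x)) ≤
        C * (∫⁻ x in Ω, ENNReal.ofReal (subcritPow N (q x) (a x) (u x) *
          (1 + (|Real.log (a x)| + |Real.log (u x)| + 1 / a x + ‖fderiv ℝ u x‖ / u x)))) ^
            (N / (N - 1)) := by
  have hp : Real.HolderConjugate ((n + 1 : ℕ) : ℝ) (N / (N - 1)) := by
    rw [← hNn]; exact Real.HolderConjugate.conjExponent hN
  obtain ⟨C, hC, hSob⟩ := hΩ.exists_lintegral_rpow_le hp
  obtain ⟨M, hM, hgrad⟩ := exists_isLineGradBound_subcritPow hN.le hc K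
  have hp0 : 0 ≤ N / (N - 1) := div_nonneg (by linarith) (by linarith)
  refine ⟨C * ENNReal.ofReal (1 + M) ^ (N / (N - 1)),
    ENNReal.mul_ne_top hC (ENNReal.rpow_ne_top_of_nonneg hp0 ENNReal.ofReal_ne_top),
    fun q a u hq ha hq0 hqN ha0 hu hu0 => ?_⟩
  have hqN' : ∀ x, q x < N := fun x => by linarith [hqN x]
  have hφc := continuous_subcritPow hq.continuous ha.continuous hu.continuous hqN' ha0 hu0
  have hφ0 := fun x => subcritPow_nonneg (N := N) (q := q x) (ha0 x).le (hu0 x).le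
  have hfd : Measurable fun x => fderiv ℝ u x := (hu.continuous_fderiv one_ne_zero).measurable
  have key := hSob _ _ hφc.measurable.ennreal_ofReal (by
    have := hφc.measurable
    have := ha.continuous.measurable
    have := hu.continuous.measurable
    fun_prop) (hgrad q a u hq ha hq0 hqN ha0 hu hu0)
  calc ∫⁻ x in Ω, ENNReal.ofReal (critPow N (q x) (a x) (u x))
      = ∫⁻ x in Ω, ENNReal.ofReal (subcritPow N (q x) (a x) (u x)) ^ (N / (N - 1)) := by
        simp_rw [ENNReal.ofReal_rpow_of_nonneg (hφ0 _) hp0,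
          subcritPow_rpow hN (ha0 _).le (hu0 _).le]
    _ ≤ C * (∫⁻ x in Ω, ENNReal.ofReal (1 + M) *
          ENNReal.ofReal (subcritPow N (q x) (a x) (u x) *
          (1 + (|Real.log (a x)| + |Real.log (u x)| + 1 / a x + ‖fderiv ℝ u x‖ / u x)))) ^
            (N / (N - 1)) := by
        refine key.trans ?_
        gcongr with x
        have h1 : 0 ≤ |Real.log (a x)| + |Real.log (u x)| + 1 / a x + ‖fderiv ℝ u x‖ / u x := by
          have := ha0 x
          have := hu0 x
          positivity
        set G := |Real.log (a x)| + |Real.log (u x)| + 1 / a x + ‖fderiv ℝ u x‖ / u x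
        have h2 := mul_nonneg (hφ0 x) h1
        rw [← ENNReal.ofReal_add (hφ0 x) (by positivity), ← ENNReal.ofReal_mul (by positivity)]
        apply ENNReal.ofReal_le_ofReal
        nlinarith [mul_nonneg hM (hφ0 x)]
    _ = _ := by
        rw [lintegral_const_mul' _ _ ENNReal.ofReal_ne_top, ENNReal.mul_rpow_of_nonneg _ _ hp0,
          mul_assoc]

/-- If smallness of a modular self-improves, the modular is small at a fixed scale. -/
lemma le_one_of_dyadic_descent {A : ℝ → ℝ≥0∞} {Λ : ℝ} (hΛ : 0 ≤ Λ) (hfin : A Λ ≠ ⊤)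
    (hdec : ∀ k : ℕ, A (2 ^ k * Λ) ≤ (2⁻¹) ^ k * A Λ)
    (hstep : ∀ l, Λ ≤ l → A (2 * l) ≤ 1 → A l ≤ 1) : A Λ ≤ 1 := by
  have hlim : Tendsto (fun k : ℕ => (2⁻¹ : ℝ≥0∞) ^ k * A Λ) atTop (nhds 0) := by
    have := ENNReal.Tendsto.mul_const (b := A Λ)
      (ENNReal.tendsto_pow_atTop_nhds_zero_of_lt_one
        (ENNReal.inv_lt_one.2 ENNReal.one_lt_two)) (Or.inr hfin)
    simpa using this
  obtain ⟨k, hk⟩ := (hlim.eventually_le_const one_pos).exists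
  have hdown : ∀ k : ℕ, A (2 ^ k * Λ) ≤ 1 → A Λ ≤ 1 := by
    intro k
    induction k with
    | zero => simp
    | succ k ih =>
      intro h
      refine ih (hstep _ ?_ ?_)
      · exact le_mul_of_one_le_left hΛ (one_le_pow₀ one_le_two)
      · rwa [← mul_assoc, ← pow_succ']
  exact hdown k ((hdec k).trans hk)

lemma div_rpow_le_div {t l r : ℝ} (ht : 0 ≤ t) (hl : 1 ≤ l) (hr : 1 ≤ r) :
    (t / l) ^ r ≤ t ^ r / l := by
  rw [Real.div_rpow ht (by linarith)]
  gcongr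
  exact Real.self_le_rpow_of_one_le hl hr

lemma norm_fderiv_div_const {E : Type*} [NormedAddCommGroup E] [NormedSpace ℝ E] {u : E → ℝ}
    {x : E} (hu : DifferentiableAt ℝ u x) {l : ℝ} (hl : 0 ≤ l) :
    ‖fderiv ℝ (fun x => u x / l) x‖ = ‖fderiv ℝ u x‖ / l := by
  have : fderiv ℝ (fun x => u x / l) x = l⁻¹ • fderiv ℝ u x := by
    simp_rw [div_eq_inv_mul]
    exact fderiv_const_mul hu _
  rw [this, norm_smul, Real.norm_of_nonneg (by positivity), div_eq_inv_mul]

lemma Continuous.lintegral_ofReal_ne_top {E : Type*} [NormedAddCommGroup E] [ProperSpace E]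
    [MeasurableSpace E] [BorelSpace E] {μ : Measure E} [IsFiniteMeasureOnCompacts μ]
    {Ω : Set E} (hΩ : Bornology.IsBounded Ω) {f : E → ℝ} (hf : Continuous f) :
    ∫⁻ x in Ω, ENNReal.ofReal (f x) ∂μ ≠ ⊤ := by
  have h1 : IntegrableOn f (closure Ω) μ :=
    hf.continuousOn.integrableOn_compact hΩ.isCompact_closure
  exact (h1.mono_set subset_closure).lintegral_lt_top.ne

/-- A uniform modular bound for `critPow`, from a lower order control `R` of the gradient. -/
lemma IsBoundedLipschitzDomain.exists_lintegral_critPow_div_le_one {n : ℕ}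
    {Ω : Set (EuclideanSpace ℝ (Fin (n + 1)))} (hΩ : IsBoundedLipschitzDomain Ω) {N : ℝ}
    (hNn : N = ((n + 1 : ℕ) : ℝ)) (hN : 1 < N) {c : ℝ} (hc : 0 < c) (K : NNReal)
    {Cδ : ℝ → ℝ} (hCδ : ∀ δ, 0 < δ → 0 ≤ Cδ δ) {M : ℝ} (hM : 0 ≤ M) :
    ∃ Λ : ℝ, 1 ≤ Λ ∧ ∀ (q a u : EuclideanSpace ℝ (Fin (n + 1)) → ℝ)
      (R : EuclideanSpace ℝ (Fin (n + 1)) → ℝ → ℝ → ℝ),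
      LipschitzWith K q → LipschitzWith K a → (∀ x, 1 + c ≤ q x) → (∀ x, q x ≤ N - c) →
      (∀ x, 0 < a x) → ContDiff ℝ 1 u → (∀ x, 0 < u x) →
      (∀ δ, 0 < δ → ∀ x t d, 0 < t → 0 ≤ d →
        subcritPow N (q x) (a x) t * (1 + (|Real.log (a x)| + |Real.log t| + 1 / a x + d / t)) ≤
          δ * critPow N (q x) (a x) t + Cδ δ * R x t d) →
      (∀ x t d l, 0 < t → 0 ≤ d → 1 ≤ l → R x (t / l) (d / l) ≤ R x t d / l) →
      ∫⁻ x in Ω, ENNReal.ofReal (R x (u x) ‖fderiv ℝ u x‖) ≤ ENNReal.ofReal M →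
      ∫⁻ x in Ω, ENNReal.ofReal (critPow N (q x) (a x) (u x / Λ)) ≤ 1 := by
  obtain ⟨C, hC, hSob⟩ := hΩ.exists_lintegral_critPow_le hNn hN hc K
  set p : ℝ := N / (N - 1) with hp
  have hp1 : 1 ≤ p := by rw [hp, one_le_div (by linarith)]; linarith
  set P : ℝ := N * (N / c) with hP
  set ε : ℝ := ((2 : ℝ) ^ P)⁻¹ with hε
  have hε0 : 0 < ε := by positivity
  set δ : ℝ := 1 / 2 * min 1 (ε / (C.toReal + 1)) with hδ
  have hC0 : 0 ≤ C.toReal := ENNReal.toReal_nonneg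
  have hδ0 : 0 < δ := by positivity
  have hδ1 : 2 * δ ≤ 1 := by linarith [min_le_left 1 (ε / (C.toReal + 1))]
  have hδ2 : C.toReal * (2 * δ) ≤ ε := by
    have : 2 * δ ≤ ε / (C.toReal + 1) := by linarith [min_le_right 1 (ε / (C.toReal + 1))]
    rw [le_div_iff₀ (by positivity)] at this
    nlinarith
  have hsmall : C * ENNReal.ofReal (2 * δ) ^ p ≤ ENNReal.ofReal ε := by
    rw [ENNReal.ofReal_rpow_of_nonneg (by positivity) (by linarith), ← ENNReal.ofReal_toReal hC,
      ← ENNReal.ofReal_mul hC0]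
    refine ENNReal.ofReal_le_ofReal (le_trans ?_ hδ2)
    gcongr
    simpa using Real.rpow_le_rpow_of_exponent_ge (by positivity) hδ1 hp1
  have hCd := hCδ δ hδ0
  set Λ : ℝ := max 1 (Cδ δ * M / δ) with hΛ
  have hΛ1 : 1 ≤ Λ := le_max_left _ _
  refine ⟨Λ, hΛ1, fun q a u R hq ha hq1 hqN ha0 hu hu0 hR hRs hRM => ?_⟩
  have hqN' : ∀ x, q x < N := fun x => by linarith [hqN x]
  have hexp1 : ∀ x, 1 ≤ q x * (N / (N - q x)) := fun x => by
    have h1 : 1 ≤ N / (N - q x) := by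
      rw [one_le_div (by linarith [hqN x])]
      linarith [hq1 x]
    nlinarith [hq1 x]
  have hexpP : ∀ x, q x * (N / (N - q x)) ≤ P := fun x => by
    have h1 : N / (N - q x) ≤ N / c := by
      gcongr
      linarith [hqN x]
    have h2 : 0 ≤ N / (N - q x) := div_nonneg (by linarith) (by linarith [hqN x])
    have := hqN' x
    rw [hP]
    gcongr
  have hcont : ∀ l : ℝ, 0 < l → Continuous fun x => critPow N (q x) (a x) (u x / l) :=
    fun l hl => continuous_critPow hq.continuous ha.continuous (hu.continuous.div_const l) hqN' ha0
      fun x => div_pos (hu0 x) hl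
  have hΛ0 : 0 < Λ := by linarith
  refine le_one_of_dyadic_descent
    (A := fun l => ∫⁻ x in Ω, ENNReal.ofReal (critPow N (q x) (a x) (u x / l))) hΛ0.le ?_ ?_ ?_
  · have h1 : IntegrableOn (fun x => critPow N (q x) (a x) (u x / Λ)) (closure Ω) :=
      (hcont Λ hΛ0).continuousOn.integrableOn_compact hΩ.2.1.isCompact_closure
    exact (h1.mono_set subset_closure).lintegral_lt_top.ne
  · intro k
    rw [← lintegral_const_mul' _ _ (by simp)]
    refine lintegral_mono fun x => ?_
    have h2 : (2⁻¹ : ℝ≥0∞) ^ k = ENNReal.ofReal ((2⁻¹ : ℝ) ^ k) := by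
      rw [ENNReal.ofReal_pow (by norm_num), ENNReal.ofReal_inv_of_pos two_pos]
      simp
    have h3 : u x / (2 ^ k * Λ) = (2⁻¹ : ℝ) ^ k * (u x / Λ) := by
      rw [inv_pow]; field_simp
    have hux := hu0 x
    rw [h2, ← ENNReal.ofReal_mul (by positivity), h3, critPow_mul (by positivity) (by positivity)]
    apply ENNReal.ofReal_le_ofReal
    refine mul_le_mul_of_nonneg_right ?_ (critPow_nonneg (ha0 x).le (by positivity))
    have h4 : (2⁻¹ : ℝ) ^ k ≤ 1 := pow_le_one₀ (by norm_num) (by norm_num)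
    have h5 : 0 < (2⁻¹ : ℝ) ^ k := by positivity
    exact (Real.rpow_le_rpow_of_exponent_ge h5 h4 (hexp1 x)).trans_eq (Real.rpow_one _)
  · intro l hl h2l
    have hl0 : 0 < l := by linarith
    replace h2l : ∫⁻ x in Ω, ENNReal.ofReal (critPow N (q x) (a x) (u x / (2 * l))) ≤ 1 := h2l
    have hstep1 : ∫⁻ x in Ω, ENNReal.ofReal (critPow N (q x) (a x) (u x / (2 * l))) ≤
        ENNReal.ofReal ε := by
      refine le_trans (hSob q a (fun x => u x / (2 * l)) hq ha (fun x => by linarith [hq1 x]) hqN ha0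
        (hu.div_const _) (fun x => div_pos (hu0 x) (by positivity))) (le_trans ?_ hsmall)
      gcongr
      have hder : ∀ x, ‖fderiv ℝ (fun x => u x / (2 * l)) x‖ = ‖fderiv ℝ u x‖ / (2 * l) := fun x =>
        norm_fderiv_div_const (hu.differentiable one_ne_zero x) (by positivity)
      calc _ ≤ ∫⁻ x in Ω, (ENNReal.ofReal δ *
              ENNReal.ofReal (critPow N (q x) (a x) (u x / (2 * l))) +
              ENNReal.ofReal (Cδ δ / (2 * l)) * ENNReal.ofReal (R x (u x) ‖fderiv ℝ u x‖)) := by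
            refine lintegral_mono fun x => ?_
            have hux := hu0 x
            have hd := norm_nonneg (fderiv ℝ u x)
            rw [hder, ← ENNReal.ofReal_mul hδ0.le, ← ENNReal.ofReal_mul (by positivity)]
            refine le_trans (ENNReal.ofReal_le_ofReal ?_) ENNReal.ofReal_add_le
            refine (hR δ hδ0 x (u x / (2 * l)) (‖fderiv ℝ u x‖ / (2 * l)) (by positivity)
              (by positivity)).trans ?_
            have := mul_le_mul_of_nonneg_left
              (hRs x (u x) ‖fderiv ℝ u x‖ (2 * l) hux hd (by linarith)) hCd
            calc _ ≤ _ := add_le_add_right this _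
              _ = _ := by ring
        _ = ENNReal.ofReal δ *
              (∫⁻ x in Ω, ENNReal.ofReal (critPow N (q x) (a x) (u x / (2 * l)))) +
              ENNReal.ofReal (Cδ δ / (2 * l)) *
                ∫⁻ x in Ω, ENNReal.ofReal (R x (u x) ‖fderiv ℝ u x‖) := by
            rw [lintegral_add_left, lintegral_const_mul' _ _ ENNReal.ofReal_ne_top,
              lintegral_const_mul' _ _ ENNReal.ofReal_ne_top]
            exact (hcont (2 * l) (by positivity)).measurable.ennreal_ofReal.const_mul _
        _ ≤ ENNReal.ofReal δ * 1 + ENNReal.ofReal (Cδ δ / (2 * l)) * ENNReal.ofReal M := by gcongr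
        _ ≤ ENNReal.ofReal (2 * δ) := by
            rw [mul_one, ← ENNReal.ofReal_mul (by positivity),
              ← ENNReal.ofReal_add hδ0.le (by positivity)]
            apply ENNReal.ofReal_le_ofReal
            have : Cδ δ * M / δ ≤ Λ := le_max_right _ _
            rw [div_le_iff₀ hδ0] at this
            have : Cδ δ / (2 * l) * M ≤ δ := by
              rw [div_mul_eq_mul_div, div_le_iff₀ (by positivity)]
              nlinarith
            linarith
    calc ∫⁻ x in Ω, ENNReal.ofReal (critPow N (q x) (a x) (u x / l))
        ≤ ∫⁻ x in Ω, ENNReal.ofReal (2 ^ P) *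
            ENNReal.ofReal (critPow N (q x) (a x) (u x / (2 * l))) := by
          refine lintegral_mono fun x => ?_
          have hux := hu0 x
          have h3 : u x / l = 2 * (u x / (2 * l)) := by field_simp
          rw [← ENNReal.ofReal_mul (by positivity), h3, critPow_mul zero_le_two (by positivity)]
          apply ENNReal.ofReal_le_ofReal
          refine mul_le_mul_of_nonneg_right ?_ (critPow_nonneg (ha0 x).le (by positivity))
          exact Real.rpow_le_rpow_of_exponent_le one_le_two (hexpP x)
      _ = ENNReal.ofReal (2 ^ P) *
            ∫⁻ x in Ω, ENNReal.ofReal (critPow N (q x) (a x) (u x / (2 * l))) :=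
          lintegral_const_mul' _ _ ENNReal.ofReal_ne_top
      _ ≤ ENNReal.ofReal (2 ^ P) * ENNReal.ofReal ε := by gcongr
      _ = 1 := by
          rw [← ENNReal.ofReal_mul (by positivity), hε, mul_inv_cancel₀ (by positivity),
            ENNReal.ofReal_one]

/-- Critical modular bounds for positive functions with bounded Sobolev modular. -/
lemma IsBoundedLipschitzDomain.exists_critical_modular_le_one {n : ℕ}
    {Ω : Set (EuclideanSpace ℝ (Fin (n + 1)))} (hΩ : IsBoundedLipschitzDomain Ω) {N : ℝ}
    (hNn : N = ((n + 1 : ℕ) : ℝ)) (hN : 1 < N) {c A : ℝ} (hc : 0 < c) (hA : 0 ≤ A) {K : NNReal}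
    {p q a : EuclideanSpace ℝ (Fin (n + 1)) → ℝ} (hp : LipschitzWith K p)
    (hq : LipschitzWith K q) (ha : LipschitzWith K a) (hp1 : ∀ x, 1 + c ≤ p x)
    (hpq : ∀ x, p x ≤ q x) (hqN : ∀ x, q x ≤ N - c) (hpq' : ∀ x, N * q x ≤ (N + 1) * p x)
    (ha0 : ∀ x, 0 ≤ a x) (haA : ∀ x, a x ≤ A) {M : ℝ} (hM : 0 ≤ M) :
    ∃ Λ : ℝ, 1 ≤ Λ ∧ ∀ u : EuclideanSpace ℝ (Fin (n + 1)) → ℝ, ContDiff ℝ 1 u → (∀ x, 0 < u x) →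
      ∫⁻ x in Ω, ENNReal.ofReal (u x ^ p x + ‖fderiv ℝ u x‖ ^ p x +
        a x * (u x ^ q x + ‖fderiv ℝ u x‖ ^ q x)) ≤ ENNReal.ofReal M →
      ∫⁻ x in Ω, ENNReal.ofReal (critPow N (p x) 1 (u x / Λ)) ≤ 1 ∧
        ∫⁻ x in Ω, ENNReal.ofReal (critPow N (q x) (a x) (u x / Λ)) ≤ 1 := by
  have H₁ := fun (δ : ℝ) (hδ : 0 < δ) => exists_lineGrad_one_le hN hc hδ
  choose! C₁ hC₁ h₁ using H₁
  obtain ⟨Λ₁, hΛ₁, hmod₁⟩ := hΩ.exists_lintegral_critPow_div_le_one hNn hN hc K hC₁ hM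
  have H₂ := fun (δ : ℝ) (hδ : 0 < δ) =>
    exists_lineGrad_weight_le hN hc (show 0 ≤ A + 1 by positivity) hδ
  choose! C₂ hC₂ h₂ using H₂
  obtain ⟨Λ₂, hΛ₂, hmod₂⟩ := hΩ.exists_lintegral_critPow_div_le_one hNn hN hc K hC₂
    (show 0 ≤ M + 1 + 1 by positivity)
  have hq1 : ∀ x, 1 + c ≤ q x := fun x => (hp1 x).trans (hpq x)
  have hpN : ∀ x, p x ≤ N - c := fun x => (hpq x).trans (hqN x)
  have hps : ∀ x, 1 ≤ p x * (N / (N - p x)) := fun x => by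
    have h1 : 1 ≤ N / (N - p x) := by
      rw [one_le_div (by linarith [hpN x])]
      linarith [hp1 x]
    nlinarith [hp1 x]
  have hcrit : ∀ x t, critPow N (p x) 1 t = t ^ (p x * (N / (N - p x))) := fun x t => by
    rw [critPow, Real.one_rpow, one_mul]
  have hΛ₁0 : 0 < Λ₁ := by linarith
  have hΛ₂0 : 0 < Λ₂ := by linarith
  refine ⟨Λ₁ * Λ₂, one_le_mul_of_one_le_of_one_le hΛ₁ hΛ₂, fun u hu hu0 hmod => ?_⟩
  have hP : ∫⁻ x in Ω, ENNReal.ofReal (critPow N (p x) 1 (u x / Λ₁)) ≤ 1 := by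
    refine hmod₁ p (fun _ => 1) u (fun x t d => t ^ p x + d ^ p x) hp
      ((LipschitzWith.const 1).weaken zero_le) hp1 hpN (fun _ => one_pos) hu hu0
      (fun δ hδ x t d ht hd => h₁ δ hδ _ _ _ (hp1 x) (hpN x) ht hd) (fun x t d l ht hd hl => ?_) ?_
    · rw [add_div]
      exact add_le_add (div_rpow_le_div ht.le hl (by linarith [hp1 x]))
        (div_rpow_le_div hd hl (by linarith [hp1 x]))
    · refine (lintegral_mono fun x => ENNReal.ofReal_le_ofReal ?_).trans hmod
      have := hu0 x
      have := ha0 x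
      exact le_add_of_nonneg_right (by positivity)
  set v : EuclideanSpace ℝ (Fin (n + 1)) → ℝ := fun x => u x / Λ₁ with hv
  have hvc : ContDiff ℝ 1 v := hu.div_const _
  have hv0 : ∀ x, 0 < v x := fun x => div_pos (hu0 x) hΛ₁0
  have hdv : ∀ x, ‖fderiv ℝ v x‖ = ‖fderiv ℝ u x‖ / Λ₁ := fun x =>
    norm_fderiv_div_const (hu.differentiable one_ne_zero x) hΛ₁0.le
  have hfd : Continuous fun x => ‖fderiv ℝ v x‖ := (hvc.continuous_fderiv one_ne_zero).norm
  set J := ∫⁻ x in Ω, ENNReal.ofReal (v x ^ q x + ‖fderiv ℝ v x‖ ^ q x) with hJ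
  have hJt : J ≠ ⊤ := by
    refine Continuous.lintegral_ofReal_ne_top hΩ.2.1 (Continuous.add ?_ ?_)
    · exact hvc.continuous.rpow hq.continuous fun x => Or.inl (hv0 x).ne'
    · exact hfd.rpow hq.continuous fun x => Or.inr (by linarith [hq1 x])
  set ε : ℝ := 1 / (J.toReal + 1) with hε
  have hJ0 : 0 ≤ J.toReal := ENNReal.toReal_nonneg
  have hε0 : 0 < ε := by positivity
  have hε1 : ε ≤ 1 := by
    rw [hε, div_le_one (by positivity)]
    linarith
  have hεJ : ENNReal.ofReal ε * J ≤ 1 := by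
    rw [← ENNReal.ofReal_toReal hJt, ← ENNReal.ofReal_mul hε0.le, ← ENNReal.ofReal_one]
    apply ENNReal.ofReal_le_ofReal
    rw [hε, div_mul_eq_mul_div, one_mul, div_le_one (by positivity)]
    linarith
  have hQ : ∫⁻ x in Ω, ENNReal.ofReal (critPow N (q x) (a x + ε) (v x / Λ₂)) ≤ 1 := by
    refine hmod₂ q (fun x => a x + ε) v (fun x t d => t ^ p x + t ^ (p x * (N / (N - p x))) +
        (a x + ε) * (t ^ q x + d ^ q x)) hq
      (by simpa using ha.add (LipschitzWith.const ε)) hq1 hqN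
      (fun x => add_pos_of_nonneg_of_pos (ha0 x) hε0) hvc hv0
      (fun δ hδ x t d ht hd => h₂ δ hδ (p x) (q x) (a x + ε) t d (by linarith [hp1 x]) (hpq x)
        (hpq' x) (hq1 x) (hqN x) (add_pos_of_nonneg_of_pos (ha0 x) hε0)
        (add_le_add (haA x) hε1) ht hd) (fun x t d l ht hd hl => ?_) ?_
    · have e1 := div_rpow_le_div ht.le hl (show 1 ≤ p x by linarith [hp1 x])
      have e2 := div_rpow_le_div ht.le hl (hps x)
      have e3 := div_rpow_le_div ht.le hl (show 1 ≤ q x by linarith [hq1 x])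
      have e4 := div_rpow_le_div hd hl (show 1 ≤ q x by linarith [hq1 x])
      have e5 := mul_le_mul_of_nonneg_left (add_le_add e3 e4)
        (show 0 ≤ a x + ε from add_nonneg (ha0 x) hε0.le)
      calc _ ≤ _ := add_le_add (add_le_add e1 e2) e5
        _ = _ := by ring
    · calc _ ≤ ∫⁻ x in Ω, (ENNReal.ofReal (u x ^ p x + ‖fderiv ℝ u x‖ ^ p x +
              a x * (u x ^ q x + ‖fderiv ℝ u x‖ ^ q x)) +
              ENNReal.ofReal (critPow N (p x) 1 (u x / Λ₁)) +
              ENNReal.ofReal ε * ENNReal.ofReal (v x ^ q x + ‖fderiv ℝ v x‖ ^ q x)) := by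
            refine lintegral_mono fun x => ?_
            have hux := hu0 x
            have hvx := hv0 x
            have hax := ha0 x
            have hvu : v x ≤ u x := div_le_self hux.le hΛ₁
            have hdvu : ‖fderiv ℝ v x‖ ≤ ‖fderiv ℝ u x‖ := by
              rw [hdv]
              exact div_le_self (norm_nonneg _) hΛ₁
            have hpx : 0 ≤ p x := by linarith [hp1 x]
            have hqx : 0 ≤ q x := by linarith [hq1 x]
            have e1 : v x ^ p x ≤ u x ^ p x := by gcongr
            have e3 : a x * (v x ^ q x + ‖fderiv ℝ v x‖ ^ q x) ≤
              a x * (u x ^ q x + ‖fderiv ℝ u x‖ ^ q x) := by gcongr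
            have e4 : 0 ≤ ‖fderiv ℝ u x‖ ^ p x := by positivity
            rw [hcrit, ← ENNReal.ofReal_mul hε0.le, ← ENNReal.ofReal_add (by positivity)
              (by positivity), ← ENNReal.ofReal_add (by positivity) (by positivity)]
            apply ENNReal.ofReal_le_ofReal
            change v x ^ p x + v x ^ (p x * (N / (N - p x))) + _ ≤
              _ + v x ^ (p x * (N / (N - p x))) + _
            linarith
        _ ≤ ENNReal.ofReal M + 1 + 1 := by
            rw [lintegral_add_right, lintegral_add_right,
              lintegral_const_mul' _ _ ENNReal.ofReal_ne_top]
            · exact add_le_add (add_le_add hmod hP) hεJ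
            · simp_rw [hcrit]
              have : Measurable v := hvc.continuous.measurable
              have : Measurable p := hp.continuous.measurable
              change Measurable fun x => ENNReal.ofReal (v x ^ (p x * (N / (N - p x))))
              fun_prop
            · have : Measurable v := hvc.continuous.measurable
              have : Measurable q := hq.continuous.measurable
              have : Measurable fun x => ‖fderiv ℝ v x‖ := hfd.measurable
              fun_prop
        _ = ENNReal.ofReal (M + 1 + 1) := by
            rw [ENNReal.ofReal_add (by positivity) zero_le_one, ENNReal.ofReal_add hM zero_le_one,
              ENNReal.ofReal_one]
  have hmono : ∀ x, u x / (Λ₁ * Λ₂) = v x / Λ₂ := fun x => (div_div _ _ _).symm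
  constructor
  · refine (lintegral_mono fun x => ENNReal.ofReal_le_ofReal ?_).trans hP
    rw [hcrit, hcrit, hmono]
    have hvx := hv0 x
    have := hps x
    exact Real.rpow_le_rpow (by positivity) (div_le_self hvx.le hΛ₂) (by linarith)
  · refine (lintegral_mono fun x => ENNReal.ofReal_le_ofReal ?_).trans hQ
    rw [hmono, critPow, critPow]
    have := hv0 x
    have := ha0 x
    have : 0 ≤ N / (N - q x) := div_nonneg (by linarith) (by linarith [hqN x])
    gcongr
    linarith

/-- A positive `C¹` regularization of `|w|`. -/
lemma exists_contDiff_pos_abs_le {E : Type*} [NormedAddCommGroup E] [NormedSpace ℝ E] {w : E → ℝ}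
    (hw : ContDiff ℝ 1 w) :
    ∃ v : E → ℝ, ContDiff ℝ 1 v ∧ (∀ x, 0 < v x) ∧ (∀ x, |w x| ≤ v x) ∧ (∀ x, v x ≤ |w x| + 1) ∧
      ∀ x, ‖fderiv ℝ v x‖ ≤ ‖fderiv ℝ w x‖ := by
  have hpos : ∀ x, 0 < w x ^ 2 + 1 := fun x => by positivity
  have habs : ∀ x, |w x| ≤ √(w x ^ 2 + 1) := fun x => Real.abs_le_sqrt (by linarith)
  refine ⟨fun x => √(w x ^ 2 + 1), ((hw.pow 2).add contDiff_const).sqrt fun x => (hpos x).ne',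
    fun x => Real.sqrt_pos.2 (hpos x), habs, fun x => ?_, fun x => ?_⟩
  · refine Real.sqrt_le_iff.2 ⟨by positivity, ?_⟩
    nlinarith [abs_nonneg (w x), sq_abs (w x)]
  · have h1 := (hw.differentiable one_ne_zero x).hasFDerivAt
    have h2 := (((h1.pow 2).add_const 1).sqrt (hpos x).ne').fderiv
    have h3 : fderiv ℝ (fun x => √(w x ^ 2 + 1)) x = (w x / √(w x ^ 2 + 1)) • fderiv ℝ w x := by
      refine h2.trans ?_
      rw [smul_smul]
      congr 1
      have := Real.sqrt_pos.2 (hpos x)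
      simp
      field_simp
    rw [h3, norm_smul, Real.norm_eq_abs, abs_div, abs_of_nonneg (Real.sqrt_nonneg _)]
    exact mul_le_of_le_one_left (norm_nonneg _)
      (div_le_one_of_le₀ (habs x) (Real.sqrt_nonneg _))

lemma norm_gradient_eq {n : ℕ} (u : EuclideanSpace ℝ (Fin n) → ℝ) (x : EuclideanSpace ℝ (Fin n)) :
    ‖gradient u x‖ = ‖fderiv ℝ u x‖ := by
  rw [gradient, LinearIsometryEquiv.norm_map]

lemma add_one_rpow_le {s r N : ℝ} (hs : 0 ≤ s) (hr : 0 ≤ r) (hrN : r ≤ N) :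
    (s + 1) ^ r ≤ 2 ^ N * (s ^ r + 1) := by
  have h1 : s + 1 ≤ 2 * max s 1 := by linarith [le_max_left s 1, le_max_right s 1]
  have h2 : max s 1 ^ r ≤ s ^ r + 1 := by
    rcases le_total s 1 with h | h
    · rw [max_eq_right h, Real.one_rpow]
      linarith [Real.rpow_nonneg hs r]
    · rw [max_eq_left h]
      linarith
  calc (s + 1) ^ r ≤ (2 * max s 1) ^ r := by gcongr
    _ = 2 ^ r * max s 1 ^ r := Real.mul_rpow zero_le_two (by positivity)
    _ ≤ 2 ^ N * (s ^ r + 1) := by gcongr; exact one_le_two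

lemma rpow_le_one_add_rpow {y r m : ℝ} (hy : 0 ≤ y) (hr : 0 ≤ r) (hrm : r ≤ m) :
    y ^ r ≤ 1 + y ^ m := by
  rcases le_total y 1 with h | h
  · linarith [Real.rpow_le_one hy h hr, Real.rpow_nonneg hy m]
  · linarith [Real.rpow_le_rpow_of_exponent_le h hrm]

lemma rpow_div_mul_rpow_le {N q a t s : ℝ} (hq : 0 < q) (ha : 0 ≤ a) (ht : 0 ≤ t) (hs : 0 ≤ s)
    (hsq : s ≤ q * (N / (N - q))) : a ^ (s / q) * t ^ s ≤ 1 + critPow N q a t := by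
  have h : ∀ m : ℝ, (a ^ (1 / q) * t) ^ m = a ^ (m / q) * t ^ m := fun m => by
    rw [Real.mul_rpow (by positivity) ht, ← Real.rpow_mul ha, one_div_mul_eq_div]
  rw [critPow, ← h, show N / (N - q) = q * (N / (N - q)) / q by field_simp, mul_div_cancel₀ _ hq.ne',
    ← h]
  exact rpow_le_one_add_rpow (by positivity) hs hsq

lemma continuous_Hfun {n : ℕ} {p q a : EuclideanSpace ℝ (Fin n) → ℝ}
    {f : EuclideanSpace ℝ (Fin n) → ℝ} (hp : Continuous p) (hq : Continuous q)
    (ha : Continuous a) (hf : Continuous f) (hp0 : ∀ x, 0 < p x) (hq0 : ∀ x, 0 < q x) :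
    Continuous fun x => Hfun p q a x (f x) :=
  (hf.rpow hp fun x => Or.inr (hp0 x)).add (ha.mul (hf.rpow hq fun x => Or.inr (hq0 x)))

lemma Hfun_div_le {n : ℕ} {p q a : EuclideanSpace ℝ (Fin n) → ℝ} {x : EuclideanSpace ℝ (Fin n)}
    {t l : ℝ} (hp : 1 ≤ p x) (hq : 1 ≤ q x) (ha : 0 ≤ a x) (ht : 0 ≤ t) (hl : 1 ≤ l) :
    Hfun p q a x (t / l) ≤ l⁻¹ * Hfun p q a x t := by
  have e1 := div_rpow_le_div ht hl hp
  have e2 := mul_le_mul_of_nonneg_left (div_rpow_le_div ht hl hq) ha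
  calc _ ≤ _ := add_le_add e1 e2
    _ = _ := by rw [Hfun]; ring

lemma exists_sobolev_modular_le_one {n : ℕ} {Ω : Set (EuclideanSpace ℝ (Fin n))}
    (hΩ : Bornology.IsBounded Ω) {p q a u : EuclideanSpace ℝ (Fin n) → ℝ} (hp : Continuous p)
    (hq : Continuous q) (ha : Continuous a) (hp1 : ∀ x, 1 ≤ p x) (hq1 : ∀ x, 1 ≤ q x)
    (ha0 : ∀ x, 0 ≤ a x) (hu : ContDiff ℝ 1 u) :
    ∃ τ : ℝ, 0 < τ ∧ ∫⁻ x in Ω, (ENNReal.ofReal (Hfun p q a x (‖gradient u x‖ / τ)) +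
      ENNReal.ofReal (Hfun p q a x (|u x| / τ))) ≤ 1 := by
  have hp0 : ∀ x, 0 < p x := fun x => one_pos.trans_le (hp1 x)
  have hq0 : ∀ x, 0 < q x := fun x => one_pos.trans_le (hq1 x)
  have hgc : Continuous fun x => ‖gradient u x‖ := by
    simp_rw [norm_gradient_eq]
    exact (hu.continuous_fderiv one_ne_zero).norm
  have hH0 : ∀ x t, 0 ≤ t → 0 ≤ Hfun p q a x t := fun x t ht => by
    have := ha0 x
    unfold Hfun
    positivity
  set J := ∫⁻ x in Ω, ENNReal.ofReal (Hfun p q a x ‖gradient u x‖ + Hfun p q a x |u x|)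
  have hJ : J ≠ ⊤ := Continuous.lintegral_ofReal_ne_top hΩ
    ((continuous_Hfun hp hq ha hgc hp0 hq0).add
      (continuous_Hfun hp hq ha hu.continuous.abs hp0 hq0))
  have hJ0 : 0 ≤ J.toReal := ENNReal.toReal_nonneg
  set τ := J.toReal + 1
  have hτ : 1 ≤ τ := by simp [τ]
  refine ⟨τ, by positivity, ?_⟩
  calc _ ≤ ∫⁻ x in Ω, ENNReal.ofReal τ⁻¹ *
        ENNReal.ofReal (Hfun p q a x ‖gradient u x‖ + Hfun p q a x |u x|) := by
        refine lintegral_mono fun x => ?_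
        rw [← ENNReal.ofReal_mul (by positivity),
          ← ENNReal.ofReal_add (hH0 _ _ (by positivity)) (hH0 _ _ (by positivity)), mul_add]
        exact ENNReal.ofReal_le_ofReal (add_le_add
          (Hfun_div_le (hp1 x) (hq1 x) (ha0 x) (norm_nonneg _) hτ)
          (Hfun_div_le (hp1 x) (hq1 x) (ha0 x) (abs_nonneg _) hτ))
    _ = ENNReal.ofReal (τ⁻¹ * J.toReal) := by
        rw [lintegral_const_mul' _ _ ENNReal.ofReal_ne_top, ENNReal.ofReal_mul (by positivity),
          ENNReal.ofReal_toReal hJ]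
    _ ≤ 1 := by
        rw [← ENNReal.ofReal_one]
        apply ENNReal.ofReal_le_ofReal
        rw [inv_mul_le_iff₀ (by positivity)]
        simp [τ]

/-- The regularization of `u / τ` has a bounded Sobolev modular. -/
lemma exists_pos_sobolev_modular_le {n : ℕ} {Ω : Set (EuclideanSpace ℝ (Fin n))}
    {N A τ : ℝ} (hτ : 0 < τ) (hΩ : volume Ω ≠ ⊤) (hA : 0 ≤ A)
    {p q a u : EuclideanSpace ℝ (Fin n) → ℝ} (hp0 : ∀ x, 0 ≤ p x) (hq0 : ∀ x, 0 ≤ q x)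
    (hpN : ∀ x, p x ≤ N) (hqN : ∀ x, q x ≤ N) (ha0 : ∀ x, 0 ≤ a x) (haA : ∀ x, a x ≤ A)
    (hu : ContDiff ℝ 1 u)
    (hmod : ∫⁻ x in Ω, (ENNReal.ofReal (Hfun p q a x (‖gradient u x‖ / τ)) +
      ENNReal.ofReal (Hfun p q a x (|u x| / τ))) ≤ 1) :
    ∃ v : EuclideanSpace ℝ (Fin n) → ℝ, ContDiff ℝ 1 v ∧ (∀ x, 0 < v x) ∧
      (∀ x, |u x| / τ ≤ v x) ∧
      ∫⁻ x in Ω, ENNReal.ofReal (v x ^ p x + ‖fderiv ℝ v x‖ ^ p x +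
        a x * (v x ^ q x + ‖fderiv ℝ v x‖ ^ q x)) ≤
        ENNReal.ofReal (2 ^ N * (1 + (1 + A) * (volume Ω).toReal)) := by
  obtain ⟨v, hv, hv0, huv, hvu, hdv⟩ := exists_contDiff_pos_abs_le (hu.div_const τ)
  simp_rw [abs_div, abs_of_pos hτ] at huv hvu
  refine ⟨v, hv, hv0, huv, ?_⟩
  have hH0 : ∀ x t, 0 ≤ t → 0 ≤ Hfun p q a x t := fun x t ht => by
    have := ha0 x
    unfold Hfun
    positivity
  calc _ ≤ ∫⁻ x in Ω, ENNReal.ofReal (2 ^ N) *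
        ((ENNReal.ofReal (Hfun p q a x (‖gradient u x‖ / τ)) +
          ENNReal.ofReal (Hfun p q a x (|u x| / τ))) + ENNReal.ofReal (1 + A)) := by
        refine lintegral_mono fun x => ?_
        rw [← ENNReal.ofReal_add (hH0 _ _ (by positivity)) (hH0 _ _ (by positivity)),
          ← ENNReal.ofReal_add (add_nonneg (hH0 _ _ (by positivity)) (hH0 _ _ (by positivity)))
            (by positivity), ← ENNReal.ofReal_mul (by positivity)]
        apply ENNReal.ofReal_le_ofReal
        have hd := hdv x
        rw [norm_fderiv_div_const (hu.differentiable one_ne_zero x) hτ.le, ← norm_gradient_eq u] at hd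
        have hax := ha0 x
        have hpx := hp0 x
        have hqx := hq0 x
        have hvx := hv0 x
        have hN2 : (1 : ℝ) ≤ 2 ^ N := Real.one_le_rpow one_le_two (hpx.trans (hpN x))
        have hus : 0 ≤ |u x| / τ := by positivity
        have hds : 0 ≤ ‖gradient u x‖ / τ := by positivity
        set s := |u x| / τ
        set d := ‖gradient u x‖ / τ
        have e1 : v x ^ p x ≤ 2 ^ N * (s ^ p x + 1) :=
          (Real.rpow_le_rpow hvx.le (hvu x) hpx).trans (add_one_rpow_le hus hpx (hpN x))
        have e2 : v x ^ q x ≤ 2 ^ N * (s ^ q x + 1) :=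
          (Real.rpow_le_rpow hvx.le (hvu x) hqx).trans (add_one_rpow_le hus hqx (hqN x))
        have e3 : ‖fderiv ℝ v x‖ ^ p x ≤ 2 ^ N * d ^ p x :=
          (Real.rpow_le_rpow (norm_nonneg _) hd hpx).trans
            (le_mul_of_one_le_left (by positivity) hN2)
        have e4 : ‖fderiv ℝ v x‖ ^ q x ≤ 2 ^ N * d ^ q x :=
          (Real.rpow_le_rpow (norm_nonneg _) hd hqx).trans
            (le_mul_of_one_le_left (by positivity) hN2)
        have e5 := mul_le_mul_of_nonneg_left (add_le_add e2 e4) hax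
        have e6 : (2 : ℝ) ^ N * a x ≤ 2 ^ N * A :=
          mul_le_mul_of_nonneg_left (haA x) (by positivity)
        unfold Hfun
        linarith
    _ = ENNReal.ofReal (2 ^ N) *
        ((∫⁻ x in Ω, (ENNReal.ofReal (Hfun p q a x (‖gradient u x‖ / τ)) +
          ENNReal.ofReal (Hfun p q a x (|u x| / τ)))) + ENNReal.ofReal (1 + A) * volume Ω) := by
        rw [lintegral_const_mul' _ _ ENNReal.ofReal_ne_top,
          lintegral_add_right _ measurable_const, setLIntegral_const]
    _ ≤ ENNReal.ofReal (2 ^ N) * (1 + ENNReal.ofReal (1 + A) * volume Ω) := by gcongr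
    _ = _ := by
        rw [ENNReal.ofReal_mul (by positivity),
          ENNReal.ofReal_add (p := 1) (q := (1 + A) * (volume Ω).toReal) zero_le_one
            (by positivity), ENNReal.ofReal_mul (by positivity), ENNReal.ofReal_toReal hΩ, ENNReal.ofReal_one]

lemma rpow_add_rpow_le_two_add_critPow {N p q a r s t : ℝ} (hq : 0 < q) (ha : 0 ≤ a) (ht : 0 ≤ t)
    (hr : 0 ≤ r) (hs : 0 ≤ s) (hrp : r ≤ p * (N / (N - p))) (hsq : s ≤ q * (N / (N - q))) :
    t ^ r + a ^ (s / q) * t ^ s ≤ 2 + (critPow N p 1 t + critPow N q a t) := by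
  have h1 := rpow_le_one_add_rpow ht hr hrp
  have h2 := rpow_div_mul_rpow_le hq ha ht hs hsq
  have h3 : critPow N p 1 t = t ^ (p * (N / (N - p))) := by rw [critPow, Real.one_rpow, one_mul]
  linarith

lemma CondD.exists_bounds {N : ℕ} {p q a : EuclideanSpace ℝ (Fin N) → ℝ} (hD : CondD N p q a) :
    (1 : ℝ) < N ∧ ∃ (c A : ℝ) (K : NNReal), 0 < c ∧ 0 ≤ A ∧ LipschitzWith K p ∧
      LipschitzWith K q ∧ LipschitzWith K a ∧ (∀ x, 1 + c ≤ p x) ∧ (∀ x, q x ≤ N - c) ∧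
      (∀ x, N * q x ≤ (N + 1) * p x) ∧ ∀ x, a x ≤ A := by
  obtain ⟨⟨K₁, h₁⟩, ⟨K₂, h₂⟩, ⟨K₃, h₃⟩, ⟨c₁, hc₁, hp⟩, ⟨c₂, hc₂, hq⟩, hpq, hqN, ⟨c₃, hc₃, hr⟩, ha0,
    ⟨A, hA⟩⟩ := hD
  have hN : (1 : ℝ) < N := by linarith [hp 0, hpq 0, hqN 0]
  refine ⟨hN, min (c₁ - 1) (N - c₂), A, max K₁ (max K₂ K₃), lt_min (by linarith) (by linarith),
    (ha0 0).trans (hA 0), h₁.weaken (by simp), h₂.weaken (by simp), h₃.weaken (by simp),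
    fun x => ?_, fun x => ?_, fun x => ?_, hA⟩
  · linarith [hp x, min_le_left (c₁ - 1) (N - c₂)]
  · linarith [hq x, min_le_right (c₁ - 1) (N - c₂)]
  · have hpx : 0 < p x := by linarith [hp x]
    have := (hr x).trans hc₃.le
    rw [div_le_iff₀ hpx] at this
    calc (N : ℝ) * q x ≤ N * ((1 + 1 / N) * p x) := by gcongr
      _ = (N + 1) * p x := by field_simp

/-- A bound for the modular of `w` scales, by convexity, to a Luxemburg norm bound. -/
lemma lintegral_div_le_one {n : ℕ} {Ω : Set (EuclideanSpace ℝ (Fin n))} (hΩ : MeasurableSet Ω)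
    {r s b w : EuclideanSpace ℝ (Fin n) → ℝ} {B : ℝ} (hB : 1 ≤ B) (hr : ∀ x ∈ Ω, 1 ≤ r x)
    (hs : ∀ x ∈ Ω, 1 ≤ s x) (hb : ∀ x, 0 ≤ b x) (hw : ∀ x, 0 ≤ w x)
    (h : ∫⁻ x in Ω, ENNReal.ofReal (w x ^ r x + b x * w x ^ s x) ≤ ENNReal.ofReal B) :
    ∫⁻ x in Ω, ENNReal.ofReal ((w x / B) ^ r x + b x * (w x / B) ^ s x) ≤ 1 := by
  have hB0 : 0 < B := by linarith
  calc _ ≤ ∫⁻ x in Ω, ENNReal.ofReal B⁻¹ * ENNReal.ofReal (w x ^ r x + b x * w x ^ s x) := by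
        refine setLIntegral_mono' hΩ fun x hx => ?_
        rw [← ENNReal.ofReal_mul (by positivity)]
        apply ENNReal.ofReal_le_ofReal
        have e1 := div_rpow_le_div (hw x) hB (hr x hx)
        have e2 := mul_le_mul_of_nonneg_left (div_rpow_le_div (hw x) hB (hs x hx)) (hb x)
        calc _ ≤ _ := add_le_add e1 e2
          _ = _ := by ring
    _ ≤ ENNReal.ofReal B⁻¹ * ENNReal.ofReal B := by
        rw [lintegral_const_mul' _ _ ENNReal.ofReal_ne_top]
        gcongr
    _ = 1 := by
        rw [← ENNReal.ofReal_mul (by positivity), inv_mul_cancel₀ hB0.ne', ENNReal.ofReal_one]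

/-- **Critical embedding on a bounded Lipschitz domain.** Under (D), for continuous
`r, s` on `closure Ω` with `1 ≤ r ≤ p*`, `1 ≤ s ≤ q*`, and
`F(x,t) = t^{r(x)} + a(x)^{s(x)/q(x)} t^{s(x)}`, there is `C > 0` with
`‖u‖_{L^F(Ω)} ≤ C ‖u‖_{W^{1,H}(Ω)}` for every `u ∈ C¹(ℝ^N)`. -/
theorem stmt17 {n : ℕ} (p q a : EuclideanSpace ℝ (Fin (n + 1)) → ℝ)
    (hD : CondD (n + 1) p q a)
    (Ω : Set (EuclideanSpace ℝ (Fin (n + 1)))) (hΩ : IsBoundedLipschitzDomain Ω)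
    (r s : EuclideanSpace ℝ (Fin (n + 1)) → ℝ)
    (hrcont : ContinuousOn r (closure Ω)) (hscont : ContinuousOn s (closure Ω))
    (hr : ∀ x ∈ closure Ω, 1 ≤ r x ∧ r x ≤ (n + 1) * p x / ((n + 1) - p x))
    (hs : ∀ x ∈ closure Ω, 1 ≤ s x ∧ s x ≤ (n + 1) * q x / ((n + 1) - q x)) :
    ∃ C > (0 : ℝ), ∀ u : EuclideanSpace ℝ (Fin (n + 1)) → ℝ,
      ContDiff ℝ 1 u →
      luxNormOn (fun x t => t ^ r x + a x ^ (s x / q x) * t ^ s x) Ω u ≤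
        C * sobNormOn p q a Ω u := by
  obtain ⟨hN, c, A, K, hc, hA, hp, hq, ha, hp1, hqN, hpq', haA⟩ := hD.exists_bounds
  have ha0 := hD.a_nonneg
  have hpq : ∀ x, p x ≤ q x := fun x => (hD.p_lt_q x).le
  have hp0 : ∀ x, 0 < p x := fun x => by linarith [hp1 x]
  have hq0 : ∀ x, 0 < q x := fun x => (hp0 x).trans_le (hpq x)
  have hvol : volume Ω ≠ ⊤ := hΩ.2.1.measure_lt_top.ne
  set N : ℝ := ((n + 1 : ℕ) : ℝ) with hNn
  have hNcast : (n : ℝ) + 1 = N := by simp [hNn]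
  simp_rw [hNcast, mul_comm N, mul_div_assoc] at hr hs
  have hqN' : ∀ x, q x < N := fun x => by linarith [hqN x]
  have hpN' : ∀ x, p x < N := fun x => (hpq x).trans_lt (hqN' x)
  set M : ℝ := 2 ^ N * (1 + (1 + A) * (volume Ω).toReal)
  obtain ⟨Λ, hΛ, hmod⟩ := hΩ.exists_critical_modular_le_one hNn hN hc hA hp hq ha hp1 hpq hqN hpq'
    ha0 haA (M := M) (by positivity)
  have hΛ0 : 0 < Λ := by linarith
  set B : ℝ := 2 * (volume Ω).toReal + 2
  have hB : 1 ≤ B := by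
    have : 0 ≤ (volume Ω).toReal := ENNReal.toReal_nonneg
    simp only [B]
    linarith
  have hB0 : 0 < B := by linarith
  refine ⟨Λ * B, by positivity, fun u hu => ?_⟩
  rw [← div_le_iff₀' (by positivity)]
  refine le_csInf (exists_sobolev_modular_le_one hΩ.2.1 hp.continuous hq.continuous ha.continuous
    (fun x => by linarith [hp1 x]) (fun x => by linarith [hp1 x, hpq x]) ha0 hu) ?_
  rintro τ ⟨hτ, hτu⟩
  rw [div_le_iff₀' (by positivity)]
  refine csInf_le ⟨0, fun σ hσ => hσ.1.le⟩ ⟨by positivity, ?_⟩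
  obtain ⟨v, hv, hv0, huv, hvM⟩ := exists_pos_sobolev_modular_le hτ hvol hA (fun x => (hp0 x).le)
    (fun x => (hq0 x).le) (fun x => (hpN' x).le) (fun x => (hqN' x).le) ha0 haA hu hτu
  obtain ⟨hvp, hvq⟩ := hmod v hv hv0 hvM
  have hvc : Continuous fun x => v x / Λ := hv.continuous.div_const Λ
  have hmeas : Measurable fun x => ENNReal.ofReal (critPow N (p x) 1 (v x / Λ)) :=
    (continuous_critPow hp.continuous continuous_const hvc hpN' (fun _ => one_pos)
      fun x => div_pos (hv0 x) hΛ0).measurable.ennreal_ofReal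
  have key := lintegral_div_le_one (w := fun x => |u x| / τ / Λ) (b := fun x => a x ^ (s x / q x))
    hΩ.1.measurableSet hB (fun x hx => (hr x (subset_closure hx)).1)
    (fun x hx => (hs x (subset_closure hx)).1) (fun x => Real.rpow_nonneg (ha0 x) _)
    (fun x => by positivity) <| calc
      _ ≤ ∫⁻ x in Ω, (ENNReal.ofReal 2 + (ENNReal.ofReal (critPow N (p x) 1 (v x / Λ)) +
          ENNReal.ofReal (critPow N (q x) (a x) (v x / Λ)))) := by
        refine setLIntegral_mono' hΩ.1.measurableSet fun x hx => ?_
        obtain ⟨hr1, hrp⟩ := hr x (subset_closure hx)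
        obtain ⟨hs1, hsq⟩ := hs x (subset_closure hx)
        have hax := ha0 x
        have ht : 0 ≤ v x / Λ := div_nonneg (hv0 x).le hΛ0.le
        have hc1 := critPow_nonneg (N := N) (q := p x) zero_le_one ht
        have hc2 := critPow_nonneg (N := N) (q := q x) hax ht
        rw [← ENNReal.ofReal_add hc1 hc2, ← ENNReal.ofReal_add zero_le_two (add_nonneg hc1 hc2)]
        apply ENNReal.ofReal_le_ofReal
        refine le_trans ?_ (rpow_add_rpow_le_two_add_critPow (hq0 x) hax ht
          (zero_le_one.trans hr1) (zero_le_one.trans hs1) hrp hsq)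
        have := huv x
        gcongr
      _ ≤ ENNReal.ofReal 2 * volume Ω + (1 + 1) := by
        rw [lintegral_add_left measurable_const, setLIntegral_const,
          lintegral_add_left hmeas]
        gcongr
      _ = ENNReal.ofReal B := by
        rw [ENNReal.ofReal_add (by positivity) zero_le_two, ENNReal.ofReal_mul zero_le_two,
          ENNReal.ofReal_toReal hvol, one_add_one_eq_two, ENNReal.ofReal_ofNat]
  refine le_of_eq_of_le (lintegral_congr fun x => ?_) key
  rw [show Λ * B * τ = τ * Λ * B by ring, ← div_div, ← div_div]
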